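/- arXiv:math/0003195 — 3 statements merged into one kernel-verified Lean document; each statement's English description precedes it below -/
import Mathlib

section
/- Let F_q be a finite field with q elements. A square matrix over F_q is cyclic if its characteristic polynomial equals its minimal polynomial, and c_M(n,q) denotes the proportion of cyclic matrices among all n×n matrices over F_q (the number of cyclic matrices divided by q^{n²}). Then lim_{n→∞} c_M(n,q) = (1 − q^{−5}) · ∏_{r=3}^∞ (1 − q^{−r}). -/
/-- `cyclicProportion F n` is the number of `n × n` matrices over the finite field `F`
whose characteristic polynomial equals the minimal polynomial (cyclic matrices),
divided by `q^{n²}` where `q = |F|`. -/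
noncomputable def cyclicProportion (F : Type) [Field F] [Fintype F] (n : ℕ) : ℝ :=
  (Nat.card {A : Matrix (Fin n) (Fin n) F // A.charpoly = minpoly F A} : ℝ) /
    (Fintype.card F : ℝ) ^ (n ^ 2)


section PartOne
open Polynomial

variable {F : Type} [Field F]

/-- Multiplication by the root, transported along a linear equivalence. -/
noncomputable def cycEnd {f : F[X]} {V : Type} [AddCommGroup V] [Module F V]
    (e : AdjoinRoot f ≃ₗ[F] V) : Module.End F V :=
  e.conjAlgEquiv F (Algebra.lmul F (AdjoinRoot f) (AdjoinRoot.root f))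

lemma cycEnd_apply {f : F[X]} {V : Type} [AddCommGroup V] [Module F V]
    (e : AdjoinRoot f ≃ₗ[F] V) (x : AdjoinRoot f) :
    cycEnd e (e x) = e (AdjoinRoot.root f * x) := by
  simp [cycEnd, LinearEquiv.conjAlgEquiv]

lemma minpoly_cycEnd {f : F[X]} (hf : f.Monic) {V : Type} [AddCommGroup V] [Module F V]
    (e : AdjoinRoot f ≃ₗ[F] V) : minpoly F (cycEnd e) = f := by
  rw [cycEnd, minpoly.algEquiv_eq, minpoly.algHom_eq _ Algebra.lmul_injective,
    AdjoinRoot.minpoly_root hf.ne_zero, hf.leadingCoeff]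
  simp

lemma exists_cycEnd {f : F[X]} (hf : f.Monic) {V : Type} [AddCommGroup V] [Module F V]
    [FiniteDimensional F V] (hV : Module.finrank F V = f.natDegree) (T : Module.End F V)
    (hT : minpoly F T = f) : ∃ e : AdjoinRoot f ≃ₗ[F] V, cycEnd e = T := by
  obtain ⟨x, hx⟩ := Module.exists_ker_toSpanSingleton_eq_annihilator F[X]
    (Module.AEval' T)
  obtain ⟨x, rfl⟩ := (Module.AEval'.of _).surjective x
  have hker : ∀ p : F[X], aeval T p x = 0 ↔ f ∣ p := by
    intro p
    have h1 : p ∈ LinearMap.ker (LinearMap.toSpanSingleton F[X] (Module.AEval' T)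
      (Module.AEval'.of T x)) ↔ f ∣ p := by
      rw [hx, ← Polynomial.span_minpoly_eq_annihilator, hT, Ideal.mem_span_singleton]
    rw [← h1, LinearMap.mem_ker, LinearMap.toSpanSingleton_apply]
    rw [← Module.AEval.of_aeval_smul, LinearEquiv.map_eq_zero_iff]
    rfl
  let φ : F[X] →ₗ[F] V := (LinearMap.applyₗ x) ∘ₗ (aeval T).toLinearMap
  let ψ : AdjoinRoot f →ₗ[F] V :=
    ((Ideal.span {f}).restrictScalars F).liftQ φ (by
      intro p hp
      simpa [φ, hker, Ideal.mem_span_singleton] using hp)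
  have hψ : ∀ p, ψ (AdjoinRoot.mk f p) = aeval T p x := fun p => rfl
  have hinj : Function.Injective ψ := by
    rw [injective_iff_map_eq_zero]
    intro a
    obtain ⟨p, rfl⟩ := AdjoinRoot.mk_surjective a
    rw [hψ, hker, AdjoinRoot.mk_eq_zero]
    exact id
  have : FiniteDimensional F (AdjoinRoot f) := (AdjoinRoot.powerBasis hf.ne_zero).finite
  have hfin : Module.finrank F (AdjoinRoot f) = Module.finrank F V := by
    rw [hV, (AdjoinRoot.powerBasis hf.ne_zero).finrank, AdjoinRoot.powerBasis_dim]
  refine ⟨LinearMap.linearEquivOfInjective ψ hinj hfin, ?_⟩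
  ext v
  obtain ⟨a, rfl⟩ := (LinearMap.linearEquivOfInjective ψ hinj hfin).surjective v
  rw [cycEnd_apply]
  obtain ⟨p, rfl⟩ := AdjoinRoot.mk_surjective a
  rw [← AdjoinRoot.mk_X, ← map_mul, LinearMap.linearEquivOfInjective_apply,
    LinearMap.linearEquivOfInjective_apply, hψ, hψ]
  simp

lemma eq_mul_of_comm {f : F[X]} (g : AdjoinRoot f →ₗ[F] AdjoinRoot f)
    (hg : ∀ x, g (AdjoinRoot.root f * x) = AdjoinRoot.root f * g x) (x : AdjoinRoot f) :
    g x = x * g 1 := by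
  obtain ⟨p, rfl⟩ := AdjoinRoot.mk_surjective x
  induction p using Polynomial.induction_on' with
  | add p q hp hq => simp [hp, hq, add_mul]
  | monomial n a =>
    rw [← Polynomial.C_mul_X_pow_eq_monomial, map_mul, map_pow, AdjoinRoot.mk_X, AdjoinRoot.mk_C,
      ← AdjoinRoot.algebraMap_eq, ← Algebra.smul_def, map_smul, smul_mul_assoc]
    congr 1
    induction n with
    | zero => simp
    | succ n ih => rw [pow_succ', hg, ih, mul_assoc]

lemma card_equiv_eq {f : F[X]} (hf : f.Monic) {V : Type} [AddCommGroup V] [Module F V]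
    [FiniteDimensional F V] (hV : Module.finrank F V = f.natDegree) :
    Nat.card {T : Module.End F V // minpoly F T = f} * Nat.card (AdjoinRoot f)ˣ =
      Nat.card (AdjoinRoot f ≃ₗ[F] V) := by
  rw [← Nat.card_prod]
  choose e he using fun T : {T : Module.End F V // minpoly F T = f} =>
    exists_cycEnd hf hV T.1 T.2
  let m : (AdjoinRoot f)ˣ → (AdjoinRoot f ≃ₗ[F] AdjoinRoot f) := fun u =>
    LinearEquiv.ofLinearMap (Algebra.lmul F _ (u : AdjoinRoot f))
      (Algebra.lmul F _ (↑u⁻¹ : AdjoinRoot f)) (by ext x; simp) (by ext x; simp)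
  have hm : ∀ u x, m u x = u * x := fun u x => rfl
  refine Nat.card_congr (Equiv.ofBijective (fun Tu => (m Tu.2).trans (e Tu.1)) ⟨?_, ?_⟩)
  · have key : ∀ T u, cycEnd ((m u).trans (e T)) = T.1 := by
      intro T u
      ext v
      obtain ⟨a, rfl⟩ := ((m u).trans (e T)).surjective v
      rw [cycEnd_apply, LinearEquiv.trans_apply, LinearEquiv.trans_apply, hm, hm, ← he T,
        cycEnd_apply]
      congr 1
      ring
    rintro ⟨T, u⟩ ⟨T', u'⟩ h
    simp only at h
    have hT : T = T' := by
      apply Subtype.ext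
      rw [← key T u, ← key T' u', h]
    subst hT
    have h1 := congrArg (fun g : AdjoinRoot f ≃ₗ[F] V => g 1) h
    simp only [LinearEquiv.trans_apply, hm, mul_one] at h1
    have h2 := Units.ext ((e T).injective h1)
    rw [h2]
  · intro d
    let T : {T : Module.End F V // minpoly F T = f} := ⟨cycEnd d, minpoly_cycEnd hf d⟩
    let g : AdjoinRoot f ≃ₗ[F] AdjoinRoot f := d.trans (e T).symm
    have hg : ∀ x, g (AdjoinRoot.root f * x) = AdjoinRoot.root f * g x := by
      intro x
      apply (e T).injective
      rw [← cycEnd_apply (e T), he]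
      simp [g, T, cycEnd_apply]
    have hg1 := eq_mul_of_comm g.toLinearMap hg
    obtain ⟨y, hy⟩ := g.surjective 1
    have hy1 : y * g 1 = 1 := (hg1 y).symm.trans hy
    refine ⟨(T, ⟨g 1, y, by rw [mul_comm]; exact hy1, hy1⟩), ?_⟩
    ext x
    have := hg1 x
    simp only [LinearEquiv.coe_coe] at this
    simp only [LinearEquiv.trans_apply, hm]
    rw [mul_comm, ← this]
    simp [g]

lemma card_minpoly_mul {n : ℕ} {f : F[X]} (hf : f.Monic) (hn : f.natDegree = n) :
    Nat.card {A : Matrix (Fin n) (Fin n) F // minpoly F A = f} * Nat.card (AdjoinRoot f)ˣ =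
      Nat.card (GL (Fin n) F) := by
  have hV : Module.finrank F (Fin n → F) = f.natDegree := by simp [hn]
  have h := card_equiv_eq hf hV
  have h1 : Nat.card {A : Matrix (Fin n) (Fin n) F // minpoly F A = f} =
      Nat.card {T : Module.End F (Fin n → F) // minpoly F T = f} :=
    Nat.card_congr (Matrix.toLin'.toEquiv.subtypeEquiv (fun A => by
      simp [Matrix.minpoly_toLin']))
  rw [h1, h]
  have : FiniteDimensional F (AdjoinRoot f) := (AdjoinRoot.powerBasis hf.ne_zero).finite
  have hfin : Module.finrank F (AdjoinRoot f) = Module.finrank F (Fin n → F) := by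
    rw [hV, (AdjoinRoot.powerBasis hf.ne_zero).finrank, AdjoinRoot.powerBasis_dim]
  let e0 := LinearEquiv.ofFinrankEq _ _ hfin
  have h2 : Nat.card (AdjoinRoot f ≃ₗ[F] (Fin n → F)) =
      Nat.card ((Fin n → F) ≃ₗ[F] (Fin n → F)) :=
    Nat.card_congr ⟨fun e => e0.symm.trans e, fun e => e0.trans e,
      fun e => by ext; simp, fun e => by ext; simp⟩
  rw [h2]
  exact Nat.card_congr ((LinearMap.GeneralLinearGroup.generalLinearEquiv F (Fin n → F)).symm.trans
    (Matrix.GeneralLinearGroup.toLin).symm).toEquiv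

end PartOne

section PartTwo
open Polynomial
open scoped Classical

/-- Monic irreducible polynomials. -/
abbrev MonIrr (F : Type) [Field F] : Type := {p : F[X] // p.Monic ∧ Irreducible p}

variable {F : Type} [Field F] 

/-- product of a finite set of monic irreducibles -/
noncomputable def prodT (T : Finset (MonIrr F)) : F[X] := ∏ p ∈ T, p.1

/-- degree of the product of a finite set of monic irreducibles -/
noncomputable def degT (T : Finset (MonIrr F)) : ℕ := ∑ p ∈ T, p.1.natDegree

lemma prodT_monic (T : Finset (MonIrr F)) : (prodT T).Monic :=
  monic_prod_of_monic _ _ fun p _ => p.2.1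

lemma prodT_natDegree (T : Finset (MonIrr F)) : (prodT T).natDegree = degT T :=
  natDegree_prod_of_monic _ _ fun p _ => p.2.1

lemma prodT_dvd (T : Finset (MonIrr F)) (f : F[X]) : prodT T ∣ f ↔ ∀ p ∈ T, p.1 ∣ f := by
  constructor
  · intro h p hp
    exact (Finset.dvd_prod_of_mem _ hp).trans h
  · intro h
    apply Finset.prod_dvd_of_coprime _ h
    intro p _ r _ hpr
    rcases EuclideanDomain.dvd_or_coprime p.1 r.1 p.2.2 with h1 | h1
    rotate_left
    · exact h1
    · exfalso
      apply hpr
      apply Subtype.ext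
      exact eq_of_monic_of_associated p.2.1 r.2.1
        (p.2.2.associated_of_dvd r.2.2 h1)

lemma MonIrr.natDegree_pos (p : MonIrr F) : 0 < p.1.natDegree := p.2.2.natDegree_pos

lemma degT_le_of_dvd {f : F[X]} (hf : f ≠ 0) {T : Finset (MonIrr F)} (h : prodT T ∣ f) :
    degT T ≤ f.natDegree := by
  rw [← prodT_natDegree]; exact natDegree_le_of_dvd h hf

variable [Fintype F]

instance finite_degreeLT (n : ℕ) : Finite (degreeLT F n) :=
  Finite.of_equiv _ (degreeLTEquiv F n).toEquiv.symm

lemma finite_lows (n : ℕ) : {a : F[X] | a ∈ degreeLT F n}.Finite :=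
  Set.finite_coe_iff.1 (finite_degreeLT n)

/-- polynomials of degree less than n -/
noncomputable def lows (F : Type) [Field F] [Fintype F] (n : ℕ) : Finset F[X] :=
  (finite_lows (F := F) n).toFinset

lemma mem_lows {n : ℕ} {a : F[X]} : a ∈ lows F n ↔ a ∈ degreeLT F n := by simp [lows]

lemma card_lows (n : ℕ) : (lows F n).card = Fintype.card F ^ n := by
  rw [lows, ← Set.ncard_eq_toFinset_card _ (finite_lows n), ← Nat.card_coe_set_eq]
  refine (Nat.card_congr (degreeLTEquiv F n).toEquiv).trans ?_
  simp

lemma finite_monics (n : ℕ) : {a : F[X] | a.Monic ∧ a.natDegree = n}.Finite := 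
  Set.finite_coe_iff.1 (Finite.of_equiv _ (monicEquivDegreeLT (R := F) n).symm)

/-- monic polynomials of degree n -/
noncomputable def monics (F : Type) [Field F] [Fintype F] (n : ℕ) : Finset F[X] :=
  (finite_monics (F := F) n).toFinset

lemma mem_monics {n : ℕ} {a : F[X]} : a ∈ monics F n ↔ a.Monic ∧ a.natDegree = n := by
  simp [monics]

lemma card_monics (n : ℕ) : (monics F n).card = Fintype.card F ^ n := by
  rw [monics, ← Set.ncard_eq_toFinset_card _ (finite_monics n), ← Nat.card_coe_set_eq]
  refine (Nat.card_congr
    ((monicEquivDegreeLT (R := F) n).trans (degreeLTEquiv F n).toEquiv)).trans ?_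
  simp

lemma card_monics_dvd (n : ℕ) {d : F[X]} (hd : d.Monic) :
    ((monics F n).filter (d ∣ ·)).card =
      if d.natDegree ≤ n then Fintype.card F ^ (n - d.natDegree) else 0 := by
  split_ifs with h
  · rw [← card_monics]
    symm
    apply Finset.card_bij (fun g _ => d * g)
    · intro g hg
      rw [mem_monics] at hg
      simp only [Finset.mem_filter, mem_monics, dvd_mul_right, and_true]
      refine ⟨hd.mul hg.1, ?_⟩
      rw [hd.natDegree_mul hg.1, hg.2]; omega
    · intro g _ g' _ h
      exact mul_left_cancel₀ hd.ne_zero h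
    · intro f hf
      simp only [Finset.mem_filter, mem_monics] at hf
      obtain ⟨⟨hf, hn⟩, g, rfl⟩ := hf
      have hg := hd.of_mul_monic_left hf
      refine ⟨g, ?_, rfl⟩
      rw [mem_monics]
      refine ⟨hg, ?_⟩
      rw [hd.natDegree_mul hg] at hn
      omega
  · rw [Finset.card_eq_zero, Finset.filter_eq_empty_iff]
    intro f hf hdf
    rw [mem_monics] at hf
    have := natDegree_le_of_dvd hdf hf.1.ne_zero
    omega

lemma card_lows_dvd (n : ℕ) {d : F[X]} (hd : d.Monic) (h : d.natDegree ≤ n) :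
    ((lows F n).filter (d ∣ ·)).card = Fintype.card F ^ (n - d.natDegree) := by
  have key : ∀ g : F[X], d * g ∈ degreeLT F n ↔ g ∈ degreeLT F (n - d.natDegree) := by
    intro g
    rw [mem_degreeLT, mem_degreeLT]
    by_cases hg : g = 0
    · simp [hg]
    · rw [degree_eq_natDegree hg, degree_eq_natDegree (mul_ne_zero hd.ne_zero hg),
        natDegree_mul hd.ne_zero hg]
      norm_cast
      omega
  rw [← card_lows]
  symm
  apply Finset.card_bij (fun g _ => d * g)
  · intro g hg
    rw [mem_lows] at hg
    simp only [Finset.mem_filter, mem_lows, dvd_mul_right, and_true]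
    rwa [key]
  · intro g _ g' _ h
    exact mul_left_cancel₀ hd.ne_zero h
  · intro f hf
    simp only [Finset.mem_filter, mem_lows] at hf
    obtain ⟨hf, g, rfl⟩ := hf
    exact ⟨g, by rwa [mem_lows, ← key], rfl⟩

lemma finite_B (n : ℕ) : {p : MonIrr F | p.1.natDegree ≤ n}.Finite := by
  apply Set.Finite.of_injOn (f := Subtype.val) (t := {a : F[X] | a ∈ degreeLT F (n+1)})
  · intro p hp
    simp only [Set.mem_ofPred_eq, mem_degreeLT] at hp ⊢
    rw [degree_eq_natDegree p.2.1.ne_zero]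
    norm_cast
    omega
  · exact Subtype.val_injective.injOn
  · exact finite_lows _

/-- monic irreducibles of degree at most n -/
noncomputable def boundedIrr (F : Type) [Field F] [Fintype F] (n : ℕ) : Finset (MonIrr F) :=
  (finite_B (F := F) n).toFinset

lemma mem_boundedIrr {n : ℕ} {p : MonIrr F} : p ∈ boundedIrr F n ↔ p.1.natDegree ≤ n := by
  simp [boundedIrr]

/-- finite sets of monic irreducibles of total degree at most n -/
noncomputable def setD (F : Type) [Field F] [Fintype F] (n : ℕ) : Finset (Finset (MonIrr F)) :=
  (boundedIrr F n).powerset.filter (degT · ≤ n)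

lemma mem_setD {n : ℕ} {T : Finset (MonIrr F)} : T ∈ setD F n ↔ degT T ≤ n := by
  simp only [setD, Finset.mem_filter, Finset.mem_powerset, and_iff_right_iff_imp]
  intro h p hp
  rw [mem_boundedIrr]
  exact (Finset.single_le_sum (f := fun p : MonIrr F => p.1.natDegree)
    (fun _ _ => Nat.zero_le _) hp).trans h

/-- irreducible monic divisors of f, of degree at most that of f -/
noncomputable def primesOf (f : F[X]) : Finset (MonIrr F) :=
  (boundedIrr F f.natDegree).filter (fun p => p.1 ∣ f)

lemma mem_primesOf {f : F[X]} (hf : f ≠ 0) {p : MonIrr F} : p ∈ primesOf f ↔ p.1 ∣ f := by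
  simp only [primesOf, Finset.mem_filter, mem_boundedIrr, and_iff_right_iff_imp]
  intro h
  exact natDegree_le_of_dvd h hf

lemma subset_primesOf {f : F[X]} (hf : f ≠ 0) {T : Finset (MonIrr F)} :
    T ⊆ primesOf f ↔ prodT T ∣ f := by
  rw [prodT_dvd]
  exact forall₂_congr fun p _ => mem_primesOf hf

lemma sum_powerset_primesOf {n : ℕ} (w : Finset (MonIrr F) → ℝ) :
    ∑ f ∈ monics F n, ∑ T ∈ (primesOf f).powerset, w T =
      ∑ T ∈ setD F n, w T * (Fintype.card F : ℝ) ^ (n - degT T) := by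
  have h1 : ∀ f ∈ monics F n, ∑ T ∈ (primesOf f).powerset, w T =
      ∑ T ∈ setD F n, if prodT T ∣ f then w T else 0 := by
    intro f hf
    rw [mem_monics] at hf
    rw [← Finset.sum_filter]
    apply Finset.sum_congr _ fun _ _ => rfl
    ext T
    simp only [Finset.mem_powerset, Finset.mem_filter, mem_setD, subset_primesOf hf.1.ne_zero]
    constructor
    · intro h
      exact ⟨hf.2 ▸ degT_le_of_dvd hf.1.ne_zero h, h⟩
    · exact fun h => h.2
  rw [Finset.sum_congr rfl h1, Finset.sum_comm]
  apply Finset.sum_congr rfl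
  intro T hT
  rw [mem_setD] at hT
  rw [← Finset.sum_filter, Finset.sum_const, card_monics_dvd _ (prodT_monic T), prodT_natDegree,
    if_pos hT]
  simp [mul_comm]

lemma card_lows_coprime {n : ℕ} {f : F[X]} (hf : f ∈ monics F n) :
    (((lows F n).filter (fun a => ∀ p ∈ primesOf f, ¬ p.1 ∣ a)).card : ℝ) =
      (Fintype.card F : ℝ) ^ n *
        ∏ p ∈ primesOf f, (1 - ((Fintype.card F : ℝ) ^ p.1.natDegree)⁻¹) := by
  have hq : (Fintype.card F : ℝ) ≠ 0 := by simp
  rw [mem_monics] at hf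
  have h1 : ∀ a : F[X], (if ∀ p ∈ primesOf f, ¬ p.1 ∣ a then (1 : ℝ) else 0) =
      ∑ T ∈ (primesOf f).powerset, if prodT T ∣ a then (-1 : ℝ) ^ T.card else 0 := by
    intro a
    have : ∀ T : Finset (MonIrr F), (if prodT T ∣ a then (-1 : ℝ) ^ T.card else 0) =
      ∏ p ∈ T, (if p.1 ∣ a then (-1 : ℝ) else 0) := by
      intro T
      split_ifs with h
      · rw [prodT_dvd] at h
        rw [Finset.prod_congr rfl fun p hp => if_pos (h p hp)]
        simp
      · rw [prodT_dvd] at h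
        push Not at h
        obtain ⟨p, hp, hpa⟩ := h
        exact (Finset.prod_eq_zero hp (if_neg hpa)).symm
    simp_rw [this]
    rw [← Finset.prod_one_add]
    split_ifs with h
    · symm
      apply Finset.prod_eq_one
      intro p hp
      rw [if_neg (h p hp)]; simp
    · push Not at h
      obtain ⟨p, hp, hpa⟩ := h
      exact (Finset.prod_eq_zero hp (by rw [if_pos hpa]; simp)).symm
  rw [Finset.card_filter]
  push_cast
  simp_rw [h1]
  rw [Finset.sum_comm]
  simp_rw [sub_eq_add_neg]
  rw [Finset.prod_one_add, Finset.mul_sum]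
  apply Finset.sum_congr rfl
  intro T hT
  rw [Finset.mem_powerset, subset_primesOf hf.1.ne_zero] at hT
  have hT := degT_le_of_dvd hf.1.ne_zero hT
  rw [hf.2] at hT
  rw [← Finset.sum_filter, Finset.sum_const, card_lows_dvd _ (prodT_monic T)
    (by rwa [prodT_natDegree]), prodT_natDegree, nsmul_eq_mul, Finset.prod_neg, Finset.prod_inv_distrib,
    Finset.prod_pow_eq_pow_sum]
  change _ = _ * (_ * (_ ^ degT T)⁻¹)
  push_cast
  rw [pow_sub₀ _ hq hT]
  ring

lemma card_units {n : ℕ} {f : F[X]} (hf : f ∈ monics F n) :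
    Nat.card (AdjoinRoot f)ˣ =
      ((lows F n).filter (fun a => ∀ p ∈ primesOf f, ¬ p.1 ∣ a)).card := by
  rw [mem_monics] at hf
  have hunit : ∀ a : F[X], IsUnit (AdjoinRoot.mk f a) ↔ ∀ p ∈ primesOf f, ¬ p.1 ∣ a := by
    intro a
    constructor
    · intro h p hp hpa
      rw [mem_primesOf hf.1.ne_zero] at hp
      obtain ⟨b, hb⟩ := h.exists_right_inv
      obtain ⟨b, rfl⟩ := AdjoinRoot.mk_surjective b
      rw [← map_mul, ← map_one (AdjoinRoot.mk f), AdjoinRoot.mk_eq_mk] at hb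
      apply p.2.2.not_isUnit
      rw [isUnit_iff_dvd_one]
      have := dvd_sub (hpa.mul_right b) (hp.trans hb)
      simpa using this
    · intro h
      have hc : IsCoprime a f := by
        apply isCoprime_of_irreducible_dvd
        · rintro ⟨_, h0⟩; exact hf.1.ne_zero h0
        · intro z hz hza hzf
          have hz' : Associated (normalize z) z := normalize_associated z
          refine h ⟨normalize z, monic_normalize hz.ne_zero, hz'.symm.irreducible hz⟩ ?_ ?_
          · rw [mem_primesOf hf.1.ne_zero]
            exact hz'.dvd.trans hzf
          · exact hz'.dvd.trans hza
      obtain ⟨u, v, huv⟩ := hc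
      have := congrArg (AdjoinRoot.mk f) huv
      simp only [map_add, map_mul, AdjoinRoot.mk_self, mul_zero, add_zero, map_one] at this
      exact IsUnit.of_mul_eq_one_right _ this
  rw [← Fintype.card_coe, ← Nat.card_eq_fintype_card]
  have hmem : ∀ a : F[X], a ∈ (lows F n).filter (fun a => ∀ p ∈ primesOf f, ¬ p.1 ∣ a) ↔
      a.degree < f.degree ∧ IsUnit (AdjoinRoot.mk f a) := by
    intro a
    rw [Finset.mem_filter, hunit, mem_lows, mem_degreeLT, degree_eq_natDegree hf.1.ne_zero, hf.2]
  symm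
  refine Nat.card_congr (Equiv.ofBijective (fun a => ((hmem a.1).1 a.2).2.unit) ⟨?_, ?_⟩)
  · intro a b hab
    have h1 := congrArg Units.val hab
    simp only [IsUnit.unit_spec] at h1
    rw [AdjoinRoot.mk_eq_mk] at h1
    apply Subtype.ext
    by_contra hne
    have h2 := degree_le_of_dvd h1 (sub_ne_zero.2 hne)
    have h3 := (degree_sub_le a.1 b.1).trans_lt
      (max_lt ((hmem a.1).1 a.2).1 ((hmem b.1).1 b.2).1)
    exact absurd h3 (not_lt.2 h2)
  · intro u
    obtain ⟨a, ha⟩ := AdjoinRoot.mk_surjective u.val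
    have h1 : AdjoinRoot.mk f (a %ₘ f) = u.val := by
      rw [← ha, AdjoinRoot.mk_eq_mk]
      refine ⟨- (a /ₘ f), ?_⟩
      have := modByMonic_add_div a f
      linear_combination this
    refine ⟨⟨a %ₘ f, (hmem _).2 ⟨degree_modByMonic_lt _ hf.1, h1 ▸ u.isUnit⟩⟩, ?_⟩
    apply Units.ext
    exact h1

end PartTwo
section PartThree
open Polynomial
open scoped Classical

variable {F : Type} [Field F] [Fintype F]

lemma one_lt_q : (1 : ℝ) < Fintype.card F := by
  exact_mod_cast Fintype.one_lt_card

/-- the norm of a monic irreducible -/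
noncomputable def nrm (p : MonIrr F) : ℝ := (Fintype.card F : ℝ) ^ p.1.natDegree

lemma two_le_nrm (p : MonIrr F) : 2 ≤ nrm p := by
  have h : (2 : ℝ) ≤ Fintype.card F := by exact_mod_cast Fintype.one_lt_card (α := F)
  calc (2 : ℝ) ≤ Fintype.card F := h
    _ = (Fintype.card F : ℝ) ^ 1 := (pow_one _).symm
    _ ≤ _ := pow_le_pow_right₀ (by linarith) p.natDegree_pos

lemma prod_nrm (T : Finset (MonIrr F)) : ∏ p ∈ T, nrm p = (Fintype.card F : ℝ) ^ degT T := by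
  simp only [nrm, degT, Finset.prod_pow_eq_pow_sum]

lemma card_units_real {n : ℕ} {f : F[X]} (hf : f ∈ monics F n) :
    (Nat.card (AdjoinRoot f)ˣ : ℝ) =
      (Fintype.card F : ℝ) ^ n * ∏ p ∈ primesOf f, (1 - (nrm p)⁻¹) := by
  rw [card_units hf, card_lows_coprime hf]
  rfl

lemma sum_inv_units (n : ℕ) :
    ∑ f ∈ monics F n, (Nat.card (AdjoinRoot f)ˣ : ℝ)⁻¹ =
      ∑ T ∈ setD F n, ∏ p ∈ T, (nrm p * (nrm p - 1))⁻¹ := by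
  have hq : (Fintype.card F : ℝ) ≠ 0 := by simp
  have h1 : ∀ f ∈ monics F n, (Nat.card (AdjoinRoot f)ˣ : ℝ)⁻¹ =
      ∑ T ∈ (primesOf f).powerset, ((Fintype.card F : ℝ) ^ n)⁻¹ * ∏ p ∈ T, (nrm p - 1)⁻¹ := by
    intro f hf
    rw [card_units_real hf, mul_inv, ← Finset.mul_sum, ← Finset.prod_one_add,
      ← Finset.prod_inv_distrib]
    congr 1
    apply Finset.prod_congr rfl
    intro p _
    have := two_le_nrm p
    have h2 : nrm p ≠ 0 := by positivity
    have h3 : nrm p - 1 ≠ 0 := by linarith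
    field_simp
    ring
  rw [Finset.sum_congr rfl h1, sum_powerset_primesOf]
  apply Finset.sum_congr rfl
  intro T hT
  rw [mem_setD] at hT
  simp_rw [mul_inv]
  rw [Finset.prod_mul_distrib, Finset.prod_inv_distrib (s := T) (f := nrm), prod_nrm, pow_sub₀ _ hq hT]
  field_simp

lemma sum_moebius (n : ℕ) :
    ∑ T ∈ setD F n, (-1 : ℝ) ^ T.card * ((Fintype.card F : ℝ) ^ degT T)⁻¹ =
      if n = 0 then 1 else 0 := by
  have hq : (Fintype.card F : ℝ) ≠ 0 := by simp
  have h := sum_powerset_primesOf (F := F) (n := n) (fun T => (-1 : ℝ) ^ T.card)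
  have h1 : ∀ f ∈ monics F n, ∑ T ∈ (primesOf f).powerset, (-1 : ℝ) ^ T.card =
      if n = 0 then 1 else 0 := by
    intro f hf
    rw [mem_monics] at hf
    have h2 := Finset.sum_powerset_neg_one_pow_card (x := primesOf f)
    have h3 : (∑ T ∈ (primesOf f).powerset, (-1 : ℝ) ^ T.card) =
        ((if primesOf f = ∅ then 1 else 0 : ℤ) : ℝ) := by
      rw [← h2]; push_cast; rfl
    rw [h3]
    have h4 : primesOf f = ∅ ↔ n = 0 := by
      constructor
      · intro he
        by_contra hn
        obtain ⟨z, hz, hzf⟩ := exists_irreducible_of_natDegree_pos (f := f) (by omega)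
        have hz' : Associated (normalize z) z := normalize_associated z
        have : (⟨normalize z, monic_normalize hz.ne_zero, hz'.symm.irreducible hz⟩ : MonIrr F)
            ∈ primesOf f := by
          rw [mem_primesOf hf.1.ne_zero]
          exact hz'.dvd.trans hzf
        rw [he] at this
        simp at this
      · intro hn
        rw [Finset.eq_empty_iff_forall_notMem]
        intro p hp
        have := p.natDegree_pos
        rw [primesOf, Finset.mem_filter, mem_boundedIrr] at hp
        omega
    simp only [h4]
    split_ifs <;> simp
  rw [Finset.sum_congr rfl h1, Finset.sum_const, card_monics] at h
  have h5 : ∑ T ∈ setD F n, (-1 : ℝ) ^ T.card * (Fintype.card F : ℝ) ^ (n - degT T) =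
      (Fintype.card F : ℝ) ^ n *
      ∑ T ∈ setD F n, (-1 : ℝ) ^ T.card * ((Fintype.card F : ℝ) ^ degT T)⁻¹ := by
    rw [Finset.mul_sum]
    apply Finset.sum_congr rfl
    intro T hT
    rw [mem_setD] at hT
    rw [pow_sub₀ _ hq hT]
    ring
  rw [h5] at h
  have h6 : (Fintype.card F : ℝ) ^ n ≠ 0 := pow_ne_zero _ hq
  apply mul_left_cancel₀ h6
  rw [← h]
  simp

/-- signed count of squarefree monics of degree k -/
noncomputable def moeb (F : Type) [Field F] [Fintype F] (k : ℕ) : ℝ :=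
  ∑ T ∈ (setD F k).filter (degT · = k), (-1 : ℝ) ^ T.card

lemma sum_setD_eq (g : ℕ → ℝ) (n : ℕ) :
    ∑ T ∈ setD F n, (-1 : ℝ) ^ T.card * g (degT T) =
      ∑ k ∈ Finset.range (n + 1), moeb F k * g k := by
  rw [← Finset.sum_fiberwise_of_maps_to (g := degT) (t := Finset.range (n + 1))]
  · apply Finset.sum_congr rfl
    intro k hk
    rw [moeb, Finset.sum_mul]
    apply Finset.sum_congr
    · ext T
      simp only [Finset.mem_filter, mem_setD]
      simp only [Finset.mem_range] at hk
      omega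
    · intro T hT
      rw [(Finset.mem_filter.1 hT).2]
  · intro T hT
    rw [mem_setD] at hT
    rw [Finset.mem_range]; omega

lemma moeb_eq (k : ℕ) : moeb F k = if k = 0 then 1 else if k = 1 then -(Fintype.card F : ℝ) else 0 := by
  have hq : (Fintype.card F : ℝ) ≠ 0 := by simp
  have h : ∀ n, ∑ k ∈ Finset.range (n + 1), moeb F k * ((Fintype.card F : ℝ) ^ k)⁻¹ =
      if n = 0 then 1 else 0 := by
    intro n
    rw [← sum_moebius (F := F) n, sum_setD_eq (fun k => ((Fintype.card F : ℝ) ^ k)⁻¹)]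
  have h0 := h 0
  simp at h0
  rcases k with _ | k
  · simp [h0]
  · have h1 := h (k + 1)
    rw [Finset.sum_range_succ, h k] at h1
    rcases k with _ | k
    · simp at h1 ⊢
      field_simp at h1
      linarith
    · simpa using h1

lemma summable_nrm_sq : Summable (fun p : MonIrr F => ((nrm p) ^ 2)⁻¹) := by
  apply summable_of_sum_le (c := (1 - (Fintype.card F : ℝ)⁻¹)⁻¹)
  · intro p
    positivity
  · intro u
    have hq : (1 : ℝ) < Fintype.card F := one_lt_q
    have hq0 : (0 : ℝ) < Fintype.card F := by linarith
    let N := u.sup (fun p => p.1.natDegree)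
    have h1 : ∑ p ∈ u, ((nrm p) ^ 2)⁻¹ = ∑ k ∈ Finset.range (N + 1),
        ∑ p ∈ u with p.1.natDegree = k, ((nrm p) ^ 2)⁻¹ := by
      rw [Finset.sum_fiberwise_of_maps_to]
      intro p hp
      have : p.1.natDegree ≤ N := Finset.le_sup (f := fun p : MonIrr F => p.1.natDegree) hp
      rw [Finset.mem_range]; omega
    rw [h1]
    calc _ ≤ ∑ k ∈ Finset.range (N + 1), ((Fintype.card F : ℝ)⁻¹) ^ k := by
          apply Finset.sum_le_sum
          intro k _
          have h2 : ∑ p ∈ u with p.1.natDegree = k, ((nrm p) ^ 2)⁻¹ =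
              ((u.filter (fun p => p.1.natDegree = k)).card : ℝ) *
                (((Fintype.card F : ℝ) ^ k) ^ 2)⁻¹ := by
            rw [← nsmul_eq_mul, ← Finset.sum_const]
            apply Finset.sum_congr rfl
            intro p hp
            rw [nrm, (Finset.mem_filter.1 hp).2]
          have h3 : ((u.filter (fun p => p.1.natDegree = k)).card : ℝ) ≤
              (Fintype.card F : ℝ) ^ k := by
            rw [← Nat.cast_pow, ← card_monics (F := F)]
            norm_cast
            apply Finset.card_le_card_of_injOn Subtype.val
            · intro p hp
              rw [Finset.mem_coe, mem_monics]
              exact ⟨p.2.1, (Finset.mem_filter.1 hp).2⟩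
            · exact Subtype.val_injective.injOn
          rw [h2]
          calc _ ≤ (Fintype.card F : ℝ) ^ k * (((Fintype.card F : ℝ) ^ k) ^ 2)⁻¹ := by gcongr
            _ = _ := by
              rw [inv_pow]
              field_simp
      _ ≤ ∑' k : ℕ, ((Fintype.card F : ℝ)⁻¹) ^ k :=
          (summable_geometric_of_lt_one (by positivity) (inv_lt_one_of_one_lt₀ hq)).sum_le_tsum _
            fun _ _ => by positivity
      _ = _ := tsum_geometric_of_lt_one (by positivity) (inv_lt_one_of_one_lt₀ hq)

lemma tendsto_setD : Filter.Tendsto (setD F) Filter.atTop Filter.atTop := by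
  apply Filter.tendsto_atTop_finset_of_monotone
  · intro m n hmn T hT
    rw [mem_setD] at hT ⊢
    omega
  · intro T
    exact ⟨degT T, mem_setD.2 le_rfl⟩

lemma hasProd_zeta (s : ℕ) (hs : 2 ≤ s) :
    HasProd (fun p : MonIrr F => 1 + -((nrm p) ^ s)⁻¹)
      (1 - (Fintype.card F : ℝ)⁻¹ ^ (s - 1)) := by
  have hq : (Fintype.card F : ℝ) ≠ 0 := by simp
  apply hasProd_one_add_of_hasSum_prod
  have hsum : Summable (fun T : Finset (MonIrr F) => ∏ p ∈ T, -((nrm p) ^ s)⁻¹) := by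
    apply summable_finsetProd_of_summable_norm
    apply Summable.of_nonneg_of_le (fun _ => norm_nonneg _) _ (summable_nrm_sq (F := F))
    intro p
    have := two_le_nrm p
    rw [norm_neg, norm_inv, norm_pow, Real.norm_of_nonneg (by linarith)]
    gcongr
    linarith
  have h1 := hsum.hasSum
  have h2 := h1.comp (tendsto_setD (F := F))
  have h3 : ∀ n ≥ 1, ∑ T ∈ setD F n, ∏ p ∈ T, -((nrm p) ^ s)⁻¹ =
      (1 - (Fintype.card F : ℝ)⁻¹ ^ (s - 1)) := by
    intro n hn
    have h4 : ∀ T ∈ setD F n, ∏ p ∈ T, -((nrm p) ^ s)⁻¹ =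
        (-1 : ℝ) ^ T.card * (fun k => (((Fintype.card F : ℝ) ^ k) ^ s)⁻¹) (degT T) := by
      intro T _
      rw [Finset.prod_neg, Finset.prod_inv_distrib, Finset.prod_pow, prod_nrm]
    rw [Finset.sum_congr rfl h4, sum_setD_eq (fun k => (((Fintype.card F : ℝ) ^ k) ^ s)⁻¹)]
    simp_rw [moeb_eq]
    obtain ⟨m, rfl⟩ : ∃ m, n = m + 1 := ⟨n - 1, by omega⟩
    rw [Finset.sum_range_succ', Finset.sum_range_succ', Finset.sum_eq_zero]
    · obtain ⟨t, rfl⟩ : ∃ t, s = t + 1 := ⟨s - 1, by omega⟩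
      simp
      field_simp
      ring
    · intro k _
      simp
  have h5 : ∑' T : Finset (MonIrr F), ∏ p ∈ T, -((nrm p) ^ s)⁻¹ =
      (1 - (Fintype.card F : ℝ)⁻¹ ^ (s - 1)) := by
    refine tendsto_nhds_unique h2 ?_
    apply tendsto_const_nhds.congr'
    filter_upwards [Filter.eventually_ge_atTop 1] with n hn
    exact (h3 n hn).symm
  rw [← h5]
  exact h1

lemma tendsto_sum_inv_units :
    Filter.Tendsto (fun n => ∑ f ∈ monics F n, (Nat.card (AdjoinRoot f)ˣ : ℝ)⁻¹) Filter.atTop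
      (nhds ((1 - (Fintype.card F : ℝ)⁻¹ ^ 5) /
        ((1 - (Fintype.card F : ℝ)⁻¹) * (1 - (Fintype.card F : ℝ)⁻¹ ^ 2)))) := by
  have hq : (1 : ℝ) < Fintype.card F := one_lt_q
  simp_rw [sum_inv_units]
  have hsum : Summable (fun T : Finset (MonIrr F) => ∏ p ∈ T, (nrm p * (nrm p - 1))⁻¹) := by
    apply summable_finsetProd_of_summable_norm
    apply Summable.of_nonneg_of_le (fun _ => norm_nonneg _) _ ((summable_nrm_sq (F := F)).mul_left 2)
    intro p
    have := two_le_nrm p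
    have h0 : 0 < nrm p * (nrm p - 1) := mul_pos (by linarith) (by linarith)
    rw [Real.norm_of_nonneg (by positivity), ← div_eq_mul_inv, inv_eq_one_div,
      div_le_div_iff₀ h0 (by positivity)]
    nlinarith
  have h1 := hasProd_one_add_of_hasSum_prod hsum.hasSum
  have h2 := (h1.mul (hasProd_zeta (F := F) 2 le_rfl)).mul (hasProd_zeta (F := F) 3 (by norm_num))
  have h3 := hasProd_zeta (F := F) 6 (by norm_num)
  have h4 : (fun p : MonIrr F => (1 + (nrm p * (nrm p - 1))⁻¹) * (1 + -((nrm p) ^ 2)⁻¹) *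
      (1 + -((nrm p) ^ 3)⁻¹)) = fun p => (1 + -((nrm p) ^ 6)⁻¹) := by
    ext p
    have := two_le_nrm p
    have h5 : nrm p ≠ 0 := by positivity
    have h6 : nrm p - 1 ≠ 0 := by linarith
    field_simp
    ring
  rw [h4] at h2
  have h5 := h2.unique h3
  have h6 := hsum.hasSum.comp (tendsto_setD (F := F))
  have hi : (Fintype.card F : ℝ)⁻¹ < 1 := inv_lt_one_of_one_lt₀ hq
  have hi0 : 0 < (Fintype.card F : ℝ)⁻¹ := by positivity
  have hi2 : (Fintype.card F : ℝ)⁻¹ ^ 2 < 1 := by nlinarith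
  have h7 : (1 - (Fintype.card F : ℝ)⁻¹ ^ 5) /
        ((1 - (Fintype.card F : ℝ)⁻¹) * (1 - (Fintype.card F : ℝ)⁻¹ ^ 2)) =
      ∑' T : Finset (MonIrr F), ∏ p ∈ T, (nrm p * (nrm p - 1))⁻¹ := by
    rw [div_eq_iff (mul_ne_zero (by linarith) (by linarith))]
    norm_num at h5 ⊢
    linarith
  rw [h7]
  exact h6

lemma card_cyclic (n : ℕ) :
    (Nat.card {A : Matrix (Fin n) (Fin n) F // A.charpoly = minpoly F A} : ℝ) =
      Nat.card (GL (Fin n) F) * ∑ f ∈ monics F n, (Nat.card (AdjoinRoot f)ˣ : ℝ)⁻¹ := by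
  have h1 : Nat.card {A : Matrix (Fin n) (Fin n) F // A.charpoly = minpoly F A} =
      ∑ f ∈ monics F n, Nat.card {A : Matrix (Fin n) (Fin n) F // minpoly F A = f} := by
    simp_rw [Nat.card_eq_fintype_card, Fintype.card_subtype]
    rw [Finset.card_eq_sum_card_fiberwise (f := fun A => minpoly F A) (t := monics F n)]
    · apply Finset.sum_congr rfl
      intro f hf
      congr 1
      ext A
      simp only [Finset.mem_filter, Finset.mem_univ, true_and, and_iff_right_iff_imp]
      intro hA
      rw [mem_monics] at hf
      rw [hA]
      refine (eq_of_monic_of_dvd_of_natDegree_le hf.1 A.charpoly_monic ?_ ?_)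
      · rw [← hA]; exact A.minpoly_dvd_charpoly
      · rw [A.charpoly_natDegree_eq_dim, hf.2]; simp
    · intro A hA
      simp only [Finset.coe_filter, Finset.mem_univ, true_and, Set.mem_ofPred_eq] at hA
      rw [Finset.mem_coe, mem_monics]
      simp only [← hA]
      refine ⟨A.charpoly_monic, ?_⟩
      rw [A.charpoly_natDegree_eq_dim]; simp
  rw [h1, Finset.mul_sum]
  push_cast
  apply Finset.sum_congr rfl
  intro f hf
  have hu := card_units_real hf
  rw [mem_monics] at hf
  rw [← card_minpoly_mul hf.1 hf.2]
  have hpos : (Nat.card (AdjoinRoot f)ˣ : ℝ) ≠ 0 := by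
    rw [hu]
    apply mul_ne_zero (by simp)
    rw [Finset.prod_ne_zero_iff]
    intro p _
    have := two_le_nrm p
    have : (nrm p)⁻¹ < 1 := inv_lt_one_of_one_lt₀ (by linarith)
    linarith
  push_cast
  field_simp

lemma card_GL_div (n : ℕ) :
    (Nat.card (GL (Fin n) F) : ℝ) / (Fintype.card F : ℝ) ^ (n ^ 2) =
      ∏ i ∈ Finset.range n, (1 - (Fintype.card F : ℝ)⁻¹ ^ (i + 1)) := by
  have hq : (Fintype.card F : ℝ) ≠ 0 := by simp
  rw [Matrix.card_GL_field, Nat.cast_prod, pow_two, pow_mul, Finset.prod_range,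
    ← Equiv.prod_comp Fin.revPerm]
  have : ((Fintype.card F : ℝ) ^ n) ^ n = ∏ i : Fin n, (Fintype.card F : ℝ) ^ n := by simp
  rw [this, ← Finset.prod_div_distrib]
  apply Finset.prod_congr rfl
  intro i _
  have hi : n - (i + 1) ≤ n := by omega
  rw [Fin.revPerm_apply, Fin.val_rev, Nat.cast_sub (Nat.pow_le_pow_right Fintype.card_pos hi)]
  push_cast
  rw [pow_sub₀ _ hq (by omega), inv_pow]
  field_simp

end PartThree

theorem tendsto_cyclicProportion' {F : Type} [Field F] [Fintype F] (q : ℕ)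
    (hq : Fintype.card F = q) :
    Filter.Tendsto (fun n => (Nat.card {A : Matrix (Fin n) (Fin n) F // A.charpoly = minpoly F A} : ℝ) /
    (Fintype.card F : ℝ) ^ (n ^ 2)) Filter.atTop
      (nhds ((1 - ((q : ℝ))⁻¹ ^ 5) * ∏' r : ℕ, (1 - ((q : ℝ))⁻¹ ^ (r + 3)))) := by
  subst hq
  have h1 : (1 : ℝ) < Fintype.card F := one_lt_q
  have hi : (Fintype.card F : ℝ)⁻¹ < 1 := inv_lt_one_of_one_lt₀ h1
  have hi0 : 0 < (Fintype.card F : ℝ)⁻¹ := by positivity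
  have hi2 : (Fintype.card F : ℝ)⁻¹ ^ 2 < 1 := by nlinarith
  have hmul : Multipliable (fun r : ℕ => 1 - (Fintype.card F : ℝ)⁻¹ ^ (r + 3)) := by
    simp_rw [sub_eq_add_neg]
    apply multipliable_one_add_of_summable
    simp_rw [norm_neg, norm_pow, pow_add]
    apply Summable.mul_right
    apply summable_geometric_of_lt_one (norm_nonneg _)
    rwa [Real.norm_of_nonneg hi0.le]
  have h2 := hmul.hasProd.tendsto_prod_nat
  have h3 : Filter.Tendsto (fun n => ∏ i ∈ Finset.range n, (1 - (Fintype.card F : ℝ)⁻¹ ^ (i + 1)))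
      Filter.atTop (nhds ((∏' r : ℕ, (1 - (Fintype.card F : ℝ)⁻¹ ^ (r + 3))) *
        (1 - (Fintype.card F : ℝ)⁻¹ ^ 2) * (1 - (Fintype.card F : ℝ)⁻¹))) := by
    rw [← Filter.tendsto_add_atTop_iff_nat 2]
    simp_rw [Finset.prod_range_succ']
    simpa using (h2.mul_const _).mul_const _
  have h4 := h3.mul (tendsto_sum_inv_units (F := F))
  have h5 : ∀ n, (Nat.card {A : Matrix (Fin n) (Fin n) F // A.charpoly = minpoly F A} : ℝ) /
    (Fintype.card F : ℝ) ^ (n ^ 2) = (∏ i ∈ Finset.range n, (1 - (Fintype.card F : ℝ)⁻¹ ^ (i + 1))) *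
      ∑ f ∈ monics F n, (Nat.card (AdjoinRoot f)ˣ : ℝ)⁻¹ := by
    intro n
    rw [card_cyclic, ← card_GL_div]
    ring
  simp_rw [h5]
  convert h4 using 2
  have h6 : 1 - (Fintype.card F : ℝ)⁻¹ ≠ 0 := by linarith
  have h7 : 1 - (Fintype.card F : ℝ)⁻¹ ^ 2 ≠ 0 := by linarith
  generalize (Fintype.card F : ℝ)⁻¹ = x at *
  field_simp

/-- `lim_{n→∞} c_M(n,q) = (1 − q^{−5}) · ∏_{r=3}^∞ (1 − q^{−r})`. -/
theorem tendsto_cyclicProportion {F : Type} [Field F] [Fintype F] (q : ℕ)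
    (hq : Fintype.card F = q) :
    Filter.Tendsto (fun n => cyclicProportion F n) Filter.atTop
      (nhds ((1 - ((q : ℝ))⁻¹ ^ 5) * ∏' r : ℕ, (1 - ((q : ℝ))⁻¹ ^ (r + 3)))) := by
  exact tendsto_cyclicProportion' q hq
end

section
/- Let F_q be a finite field with q elements. Let c_M(n,q) be the proportion of n×n matrices over F_q whose characteristic polynomial equals the minimal polynomial, and let s_M(n,q) be the proportion of n×n matrices over F_q whose characteristic polynomial is squarefree. Then for every n ≥ 0, c_M(n+1,q) − c_M(n,q) = (s_M(n+1,q) − c_M(n,q)) / q^{n+1}. -/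
/-- Proportion of separable `n × n` matrices (squarefree characteristic polynomial)
over the finite field `F`, i.e. their number divided by `q^{n²}`. -/
noncomputable def separableProportion (F : Type) [Field F] [Fintype F] (n : ℕ) : ℝ :=
  (Nat.card {A : Matrix (Fin n) (Fin n) F // Squarefree A.charpoly} : ℝ) /
    (Fintype.card F : ℝ) ^ (n ^ 2)

open Polynomial in
/-- quotient ring -/
abbrev CycQ {F : Type} [Field F] (f : F[X]) := F[X] ⧸ Ideal.span {f}

open Polynomial in
/-- the class of `X` -/
noncomputable abbrev cycX {F : Type} [Field F] (f : F[X]) : CycQ f :=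
  Ideal.Quotient.mk (Ideal.span {f}) X

open Polynomial in
theorem cyc_exists_equiv {F V : Type} [Field F] [AddCommGroup V] [Module F V]
    [FiniteDimensional F V] (f : F[X])
    (hdim : Module.finrank F V = f.natDegree) (a : Module.End F V) (ha : minpoly F a = f) :
    ∃ Φ : CycQ f ≃ₗ[F] V, ∀ x, Φ (cycX f * x) = a (Φ x) := by
  obtain ⟨v, hv⟩ := Module.exists_ker_toSpanSingleton_eq_annihilator F[X] (Module.AEval' a)
  obtain ⟨v, rfl⟩ := (Module.AEval'.of _).surjective v
  rw [← span_minpoly_eq_annihilator, ha] at hv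
  have hv' : ∀ p : F[X], aeval a p v = 0 ↔ p ∈ Ideal.span {f} := by
    intro p
    rw [← hv, LinearMap.mem_ker, LinearMap.toSpanSingleton_apply]
    rfl
  have h0 : ∀ p : F[X], p ∈ Ideal.span {f} → aeval a p = 0 := by
    intro p hp
    rw [Ideal.mem_span_singleton] at hp
    rwa [← minpoly.dvd_iff, ha]
  let ψ : CycQ f →ₐ[F] Module.End F V := Ideal.Quotient.liftₐ (Ideal.span {f}) (aeval a) h0
  let g : CycQ f →ₗ[F] V := (LinearMap.applyₗ v).comp ψ.toLinearMap
  have hg : Function.Injective g := by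
    rw [injective_iff_map_eq_zero]
    intro x hx
    obtain ⟨p, rfl⟩ := Ideal.Quotient.mk_surjective x
    exact Ideal.Quotient.eq_zero_iff_mem.2 ((hv' p).1 hx)
  refine ⟨LinearEquiv.ofInjectiveOfFinrankEq g hg ?_, ?_⟩
  · rw [hdim]; exact finrank_quotient_span_eq_natDegree
  · intro x
    have h1 : ψ (cycX f) = a := by
      change aeval a X = a
      simp
    change ψ (cycX f * x) v = a (ψ x v)
    rw [map_mul, h1]; rfl

open Polynomial in
theorem cyc_minpoly_conj {F V : Type} [Field F] [AddCommGroup V] [Module F V]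
    (f : F[X]) (hf : f.Monic) (Φ : CycQ f ≃ₗ[F] V) :
    minpoly F (Φ.conj (Algebra.lmul F (CycQ f) (cycX f))) = f := by
  have h1 : minpoly F (Φ.conj (Algebra.lmul F (CycQ f) (cycX f))) = minpoly F (cycX f) := by
    rw [← minpoly.algHom_eq (Algebra.lmul F (CycQ f)) Algebra.lmul_injective (cycX f)]
    exact minpoly.algHom_eq (Φ.conjAlgEquiv F).toAlgHom (Φ.conjAlgEquiv F).injective _
  rw [h1]
  have := AdjoinRoot.minpoly_root hf.ne_zero
  rw [hf.leadingCoeff, inv_one, C_1, mul_one] at this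
  exact this

open Polynomial in
theorem cyc_lin {F : Type} [Field F] (f : F[X]) (Ψ : CycQ f →ₗ[F] CycQ f)
    (h : ∀ x, Ψ (cycX f * x) = cycX f * Ψ x) (x : CycQ f) : Ψ x = x * Ψ 1 := by
  obtain ⟨p, rfl⟩ := Ideal.Quotient.mk_surjective x
  induction p using Polynomial.induction_on' with
  | add p q hp hq => rw [map_add, map_add, hp, hq, add_mul]
  | monomial n c =>
    have hm : Ideal.Quotient.mk (Ideal.span {f}) (monomial n c) = c • (cycX f)^n := by
      rw [← smul_X_eq_monomial, ← map_pow]; rfl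
    rw [hm, map_smul, smul_mul_assoc]
    congr 1
    clear hm
    induction n with
    | zero => simp
    | succ n ih =>
      rw [pow_succ', h, ih, mul_assoc]

open Polynomial in
/-- the number of units of the quotient -/
noncomputable def cycPhi {F : Type} [Field F] (f : F[X]) : ℕ := Nat.card (CycQ f)ˣ

theorem cyc_card_gen {F V L : Type} [Field F] [AddCommGroup V] [Module F V]
    [CommRing L] [Algebra F L] (t : L) (P : Module.End F V → Prop)
    (hex : ∀ a, P a → ∃ Φ : L ≃ₗ[F] V, ∀ x, Φ (t * x) = a (Φ x))
    (hP : ∀ Φ : L ≃ₗ[F] V, P (Φ.conj (Algebra.lmul F L t)))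
    (hlin : ∀ Ψ : L →ₗ[F] L, (∀ x, Ψ (t * x) = t * Ψ x) → ∀ x, Ψ x = x * Ψ 1) :
    Nat.card {a : Module.End F V // P a} * Nat.card Lˣ = Nat.card (L ≃ₗ[F] V) := by
  choose Φ hΦ using fun a : {a : Module.End F V // P a} => hex a.1 a.2
  let m : Lˣ → (L ≃ₗ[F] L) := fun u =>
    LinearEquiv.ofLinearMap (Algebra.lmul F _ (u : L)) (Algebra.lmul F _ ((u⁻¹ : Lˣ) : L))
      (by ext x; simp) (by ext x; simp)
  have hm : ∀ u x, m u x = u * x := fun u x => rfl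
  rw [← Nat.card_prod]
  refine Nat.card_congr (Equiv.ofBijective (fun t => (m t.2).trans (Φ t.1)) ⟨?_, ?_⟩)
  · rintro ⟨a, u⟩ ⟨b, w⟩ h
    have h' : ∀ x, Φ a (u * x) = Φ b (w * x) := fun x => LinearEquiv.congr_fun h x
    have hab : a = b := by
      apply Subtype.ext
      ext y
      obtain ⟨x, rfl⟩ := ((m u).trans (Φ a)).surjective y
      change a.1 (Φ a (u * x)) = b.1 (Φ a (u * x))
      rw [← hΦ, h', ← hΦ, mul_left_comm, h', mul_left_comm]
    subst hab
    congr 1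
    have := (Φ a).injective (h' 1)
    exact Units.ext (by simpa using this)
  · intro Θ
    let a : {a : Module.End F V // P a} := ⟨_, hP Θ⟩
    have ha : ∀ x, a.1 (Θ x) = Θ (t * x) := by
      intro x
      simp [a, LinearEquiv.conj_apply]
    let Ψ : L ≃ₗ[F] L := Θ.trans (Φ a).symm
    have hΨ : ∀ x, Ψ (t * x) = t * Ψ x := by
      intro x
      apply (Φ a).injective
      simp only [Ψ, LinearEquiv.trans_apply, LinearEquiv.apply_symm_apply, hΦ, ha]
    have hl := hlin Ψ.toLinearMap hΨ
    simp only [LinearEquiv.coe_coe] at hl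
    obtain ⟨w, hw⟩ := Ψ.surjective 1
    have hu : Ψ 1 * w = 1 := by
      rw [mul_comm, ← hl w, hw]
    refine ⟨⟨a, ⟨Ψ 1, w, hu, by rw [mul_comm, hu]⟩⟩, ?_⟩
    ext x
    change Φ a (Ψ 1 * x) = Θ x
    rw [mul_comm, ← hl x]
    simp [Ψ]

open Polynomial in
theorem cyc_card_End {F V : Type} [Field F] [AddCommGroup V] [Module F V]
    [FiniteDimensional F V] (f : F[X]) (hf : f.Monic)
    (hdim : Module.finrank F V = f.natDegree) :
    Nat.card {a : Module.End F V // minpoly F a = f} * cycPhi f =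
      Nat.card (CycQ f ≃ₗ[F] V) :=
  cyc_card_gen (cycX f) (fun a => minpoly F a = f) (cyc_exists_equiv f hdim)
    (cyc_minpoly_conj f hf) (cyc_lin f)

open Polynomial in
theorem cyc_card_matrix {F : Type} [Field F] (n : ℕ) (f : F[X]) (hf : f.Monic)
    (hdim : f.natDegree = n) :
    Nat.card {A : Matrix (Fin n) (Fin n) F // minpoly F A = f} * cycPhi f =
      Nat.card (GL (Fin n) F) := by
  have h1 : Nat.card {A : Matrix (Fin n) (Fin n) F // minpoly F A = f} =
      Nat.card {a : Module.End F (Fin n → F) // minpoly F a = f} :=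
    Nat.card_congr (Equiv.subtypeEquiv Matrix.toLin'.toEquiv (fun A => by
      simp [Matrix.minpoly_toLin']))
  rw [h1, cyc_card_End f hf (by simp [hdim])]
  have : FiniteDimensional F (CycQ f) := hf.finite_quotient
  have e : CycQ f ≃ₗ[F] (Fin n → F) := LinearEquiv.ofFinrankEq _ _ (by
    rw [finrank_quotient_span_eq_natDegree]; simp [hdim])
  refine Nat.card_congr (Equiv.trans ?_ (Matrix.GeneralLinearGroup.toLin.trans
    (LinearMap.GeneralLinearGroup.generalLinearEquiv F _)).symm.toEquiv)
  exact ⟨fun x => e.symm.trans x, fun y => e.trans y, fun x => by ext; simp, fun x => by ext; simp⟩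

open Polynomial in
theorem cyc_iff {F : Type} [Field F] {n : ℕ} (A : Matrix (Fin n) (Fin n) F) :
    A.charpoly = minpoly F A ↔ (minpoly F A).natDegree = n := by
  constructor
  · intro h
    rw [← h, Matrix.charpoly_natDegree_eq_dim, Fintype.card_fin]
  · intro h
    refine (eq_of_monic_of_dvd_of_natDegree_le (minpoly.monic (Matrix.isIntegral A))
      A.charpoly_monic A.minpoly_dvd_charpoly ?_)
    rw [Matrix.charpoly_natDegree_eq_dim, Fintype.card_fin, h]

open Polynomial in
theorem cyc_irr_dvd {F : Type} [Field F] {n : ℕ} (A : Matrix (Fin n) (Fin n) F)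
    (p : F[X]) (hp : Irreducible p) (h : p ∣ A.charpoly) : p ∣ minpoly F A := by
  have : Fact (Irreducible p) := ⟨hp⟩
  let K := AdjoinRoot p
  let r : K := AdjoinRoot.root p
  let B : Matrix (Fin n) (Fin n) K := A.map (algebraMap F K)
  have hB : B.charpoly = A.charpoly.map (algebraMap F K) := Matrix.charpoly_map A _
  have hr : r ∈ spectrum K B := by
    rw [Matrix.mem_spectrum_iff_isRoot_charpoly, hB, IsRoot, eval_map_algebraMap]
    change aeval (AdjoinRoot.root p) A.charpoly = 0
    rw [AdjoinRoot.aeval_eq, AdjoinRoot.mk_eq_zero]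
    exact h
  have h0 : aeval B ((minpoly F A).map (algebraMap F K)) = 0 := by
    rw [aeval_map_algebraMap]
    have := aeval_algHom_apply (Algebra.ofId F K).mapMatrix A (minpoly F A)
    rw [minpoly.aeval, map_zero] at this
    exact this
  have h1 := spectrum.subset_polynomial_aeval B ((minpoly F A).map (algebraMap F K))
    ⟨r, hr, rfl⟩
  rw [h0] at h1
  have : Nontrivial (Matrix (Fin n) (Fin n) K) := by
    by_contra hc
    rw [not_nontrivial_iff_subsingleton] at hc
    rw [spectrum.of_subsingleton] at hr
    exact hr
  rw [spectrum.zero_eq, Set.mem_singleton_iff] at h1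
  simp only [eval_map_algebraMap] at h1
  rw [← AdjoinRoot.mk_eq_zero, ← AdjoinRoot.aeval_eq]
  exact h1

open Polynomial in
theorem cyc_of_squarefree {F : Type} [Field F] {n : ℕ} (A : Matrix (Fin n) (Fin n) F)
    (h : Squarefree A.charpoly) : A.charpoly = minpoly F A := by
  refine eq_of_monic_of_associated A.charpoly_monic (minpoly.monic (Matrix.isIntegral A)) ?_
  obtain ⟨g, hg⟩ := A.minpoly_dvd_charpoly
  by_cases hu : IsUnit g
  · rw [hg]
    exact associated_mul_unit_left _ _ hu
  · exfalso
    have hg0 : g ≠ 0 := by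
      rintro rfl
      rw [mul_zero] at hg
      exact A.charpoly_monic.ne_zero hg
    obtain ⟨p, hp, hpg⟩ := WfDvdMonoid.exists_irreducible_factor hu hg0
    have h1 : p ∣ minpoly F A := cyc_irr_dvd A p hp (hg ▸ hpg.mul_left _)
    exact hp.not_isUnit (h p (hg ▸ mul_dvd_mul h1 hpg))

theorem cyc_units_card {R S : Type} [CommRing R] [CommRing S] [Finite R] [Finite S] (π : R →+* S)
    (hs : Function.Surjective π) (hu : ∀ x, IsUnit (π x) → IsUnit x) :
    Nat.card Rˣ * Nat.card S = Nat.card R * Nat.card Sˣ := by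
  let g : Rˣ →* Sˣ := Units.map π.toMonoidHom
  have hgs : Function.Surjective g := by
    intro y
    obtain ⟨x, hx⟩ := hs y
    obtain ⟨u, rfl⟩ := hu x (hx ▸ y.isUnit)
    exact ⟨u, Units.ext hx⟩
  have h1 : Nat.card g.ker * Nat.card Sˣ = Nat.card Rˣ := by
    rw [← Subgroup.card_mul_index g.ker, Subgroup.index_ker,
      MonoidHom.range_eq_top.2 hgs, Subgroup.card_top]
  have h2 : Nat.card π.toAddMonoidHom.ker * Nat.card S = Nat.card R := by
    rw [← AddSubgroup.card_mul_index π.toAddMonoidHom.ker, AddSubgroup.index_ker,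
      AddMonoidHom.range_eq_top.2 hs, AddSubgroup.card_top]
  have h3 : Nat.card g.ker = Nat.card π.toAddMonoidHom.ker := by
    refine Nat.card_congr (Equiv.ofBijective
      (fun u => ⟨(u.1 : R) - 1, ?_⟩) ⟨?_, ?_⟩)
    · have := congrArg Units.val (MonoidHom.mem_ker.1 u.2)
      change π ((u.1 : R) - 1) = 0
      rw [map_sub, map_one, sub_eq_zero]
      exact this
    · intro u v h
      have h' := congrArg Subtype.val h
      simp only [sub_left_inj] at h'
      exact Subtype.ext (Units.ext h')
    · rintro ⟨x, hx⟩
      have hx' : π x = 0 := hx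
      obtain ⟨u, hu'⟩ := hu (x + 1) (by rw [map_add, hx', map_one, zero_add]; exact isUnit_one)
      refine ⟨⟨u, ?_⟩, ?_⟩
      · apply Units.ext
        change π (u : R) = 1
        rw [hu', map_add, hx', map_one, zero_add]
      · apply Subtype.ext
        simp [hu']
  rw [← h1, ← h2, h3]; ring

section
open Polynomial
variable {F : Type} [Field F] [Fintype F]

theorem cyc_finite_Q (f : F[X]) (hf : f ≠ 0) : Finite (CycQ f) := by
  have : FiniteDimensional F (CycQ f) := (AdjoinRoot.powerBasis hf).finite
  exact Module.finite_of_finite F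

theorem cyc_card_Q (f : F[X]) (hf : f ≠ 0) :
    Nat.card (CycQ f) = Fintype.card F ^ f.natDegree := by
  have : FiniteDimensional F (CycQ f) := (AdjoinRoot.powerBasis hf).finite
  have := cyc_finite_Q f hf
  rw [Module.natCard_eq_pow_finrank (K := F), finrank_quotient_span_eq_natDegree,
    Nat.card_eq_fintype_card]

theorem cyc_isUnit_mk (f g : F[X]) :
    IsUnit (Ideal.Quotient.mk (Ideal.span {f}) g) ↔ IsCoprime g f := by
  rw [isUnit_iff_exists_inv]
  constructor
  · rintro ⟨b, hb⟩
    obtain ⟨b, rfl⟩ := Ideal.Quotient.mk_surjective b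
    rw [← map_mul, ← map_one (Ideal.Quotient.mk (Ideal.span {f})), Ideal.Quotient.eq,
      Ideal.mem_span_singleton] at hb
    obtain ⟨c, hc⟩ := hb
    exact ⟨b, -c, by linear_combination hc⟩
  · rintro ⟨a, b, h⟩
    refine ⟨Ideal.Quotient.mk _ a, ?_⟩
    rw [← map_mul, ← map_one (Ideal.Quotient.mk (Ideal.span {f})), Ideal.Quotient.eq,
      Ideal.mem_span_singleton]
    exact ⟨-b, by linear_combination h⟩

theorem cyc_phi_pos (f : F[X]) (hf : f ≠ 0) : 0 < cycPhi f := by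
  have := cyc_finite_Q f hf
  exact Nat.card_pos

theorem cyc_phi_one : cycPhi (1 : F[X]) = 1 := by
  have : Subsingleton (CycQ (1 : F[X])) := by
    rw [Ideal.Quotient.subsingleton_iff, Ideal.span_singleton_one]
  rw [cycPhi, Nat.card_unique]

theorem cyc_phi_mul (f g : F[X]) (h : IsCoprime f g) :
    cycPhi (f * g) = cycPhi f * cycPhi g := by
  have hI : IsCoprime (Ideal.span {f}) (Ideal.span {g}) :=
    (Ideal.isCoprime_span_singleton_iff f g).2 h
  have e1 := Ideal.quotientMulEquivQuotientProd _ _ hI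
  rw [Ideal.span_singleton_mul_span_singleton] at e1
  rw [cycPhi, cycPhi, cycPhi, ← Nat.card_prod]
  exact Nat.card_congr ((Units.mapEquiv e1.toMulEquiv).trans MulEquiv.prodUnits).toEquiv

theorem cyc_phi_irr (p : F[X]) (hp : Irreducible p) :
    cycPhi p + 1 = Fintype.card F ^ p.natDegree := by
  have : (Ideal.span {p}).IsMaximal := PrincipalIdealRing.isMaximal_of_irreducible hp
  let _ : Field (CycQ p) := Ideal.Quotient.field _
  have := cyc_finite_Q p hp.ne_zero
  rw [← cyc_card_Q p hp.ne_zero, cycPhi]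
  have h := Nat.card_units (CycQ p)
  have h2 : 0 < Nat.card (CycQ p) := Nat.card_pos
  have h3 : Nat.card (CycQ p)ˣ + 1 = Nat.card (CycQ p) := by omega
  exact h3

theorem cyc_phi_dvd (p m : F[X]) (hp : p ≠ 0) (hm : m ≠ 0) (h : p ∣ m) :
    cycPhi (p * m) = Fintype.card F ^ p.natDegree * cycPhi m := by
  have hpm := mul_ne_zero hp hm
  have := cyc_finite_Q _ hpm
  have := cyc_finite_Q _ hm
  have hle : Ideal.span {p * m} ≤ Ideal.span {m} := by
    rw [Ideal.span_singleton_le_span_singleton]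
    exact dvd_mul_left _ _
  have key := cyc_units_card (Ideal.Quotient.factor hle) (Ideal.Quotient.factor_surjective hle) (by
    intro x hx
    obtain ⟨g, rfl⟩ := Ideal.Quotient.mk_surjective x
    rw [Ideal.Quotient.factor_mk, cyc_isUnit_mk] at hx
    rw [cyc_isUnit_mk]
    exact IsCoprime.mul_right (hx.of_isCoprime_of_dvd_right h) hx)
  have h1 := cyc_card_Q _ hpm
  have h2 := cyc_card_Q _ hm
  unfold CycQ at h1 h2
  rw [h1, h2, natDegree_mul hp hm, pow_add] at key
  have hq : 0 < Fintype.card F ^ m.natDegree := pow_pos Fintype.card_pos _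
  apply Nat.eq_of_mul_eq_mul_right hq
  rw [cycPhi, cycPhi, key]; ring

/-- monic polynomials of degree at most `n` -/
theorem cyc_finite_le (n : ℕ) : {p : F[X] | p.Monic ∧ p.natDegree ≤ n}.Finite := by
  have : Finite (degreeLT F (n+1)) :=
    Finite.of_equiv _ (degreeLTEquiv F (n+1)).symm.toEquiv
  refine (Set.toFinite (degreeLT F (n+1) : Set F[X])).subset ?_
  rintro p ⟨-, hp⟩
  rw [SetLike.mem_coe, mem_degreeLT]
  exact lt_of_le_of_lt (degree_le_of_natDegree_le hp) (by exact_mod_cast Nat.lt_succ_self n)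

variable (F) in
/-- monic polynomials of degree at most `n` -/
noncomputable def cycU (n : ℕ) : Finset F[X] := (cyc_finite_le (F := F) n).toFinset

theorem cyc_mem_U (n : ℕ) (p : F[X]) : p ∈ cycU F n ↔ p.Monic ∧ p.natDegree ≤ n := by
  simp [cycU]

open Classical in
variable (F) in
/-- monic polynomials of degree `n` -/
noncomputable def cycM (n : ℕ) : Finset F[X] := (cycU F n).filter (fun p => p.natDegree = n)

theorem cyc_mem_M (n : ℕ) (p : F[X]) : p ∈ cycM F n ↔ p.Monic ∧ p.natDegree = n := by
  rw [cycM, Finset.mem_filter, cyc_mem_U]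
  grind

theorem cyc_card_M (n : ℕ) : (cycM F n).card = Fintype.card F ^ n := by
  have e : (cycM F n) ≃ (Fin n → F) := ((Equiv.subtypeEquivRight (cyc_mem_M n)).trans
    (monicEquivDegreeLT n)).trans (degreeLTEquiv F n).toEquiv
  rw [← Fintype.card_coe, Fintype.card_congr e]
  simp

open Classical in
theorem cyc_card_multiples (n : ℕ) (d : F[X]) (hd : d.Monic) (hn : d.natDegree ≤ n) :
    ((cycM F n).filter (fun f => d ∣ f)).card = Fintype.card F ^ (n - d.natDegree) := by
  rw [← cyc_card_M]
  symm
  refine Finset.card_bij (fun g _ => d * g) ?_ ?_ ?_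
  · intro g hg
    rw [cyc_mem_M] at hg
    rw [Finset.mem_filter, cyc_mem_M]
    refine ⟨⟨hd.mul hg.1, ?_⟩, dvd_mul_right _ _⟩
    rw [hd.natDegree_mul hg.1, hg.2]; omega
  · intro a _ b _ h
    exact mul_left_cancel₀ hd.ne_zero h
  · intro f hf
    rw [Finset.mem_filter, cyc_mem_M] at hf
    obtain ⟨⟨hf, hfn⟩, g, rfl⟩ := hf
    have hg : g.Monic := hd.of_mul_monic_left hf
    refine ⟨g, ?_, rfl⟩
    rw [cyc_mem_M]
    rw [hd.natDegree_mul hg] at hfn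
    exact ⟨hg, by omega⟩

open Classical in
/-- monic squarefree divisors -/
noncomputable def cycD (f : F[X]) : Finset F[X] :=
  (cycU F f.natDegree).filter (fun d => Squarefree d ∧ d ∣ f)

theorem cyc_mem_D (f d : F[X]) (hf : f ≠ 0) :
    d ∈ cycD f ↔ d.Monic ∧ Squarefree d ∧ d ∣ f := by
  simp only [cycD, Finset.mem_filter, cyc_mem_U]
  constructor
  · rintro ⟨⟨h1, -⟩, h2⟩; exact ⟨h1, h2⟩
  · rintro ⟨h1, h2⟩; exact ⟨⟨h1, natDegree_le_of_dvd h2.2 hf⟩, h2⟩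

theorem cyc_D_dvd (p m : F[X]) (hp : Irreducible p) (hm : m ≠ 0) (h : p ∣ m) :
    cycD (p * m) = cycD m := by
  ext d
  rw [cyc_mem_D _ _ (mul_ne_zero hp.ne_zero hm), cyc_mem_D _ _ hm]
  refine and_congr_right fun _ => and_congr_right fun hs => ⟨fun hd => ?_, fun hd => hd.mul_left _⟩
  by_cases hpd : p ∣ d
  · obtain ⟨e, rfl⟩ := hpd
    have hem : e ∣ m := (mul_dvd_mul_iff_left hp.ne_zero).1 hd
    have hpe : IsCoprime p e := by
      rw [hp.coprime_iff_not_dvd]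
      intro hpe
      exact hp.not_isUnit (hs p (mul_dvd_mul_left p hpe))
    exact hpe.mul_dvd h hem
  · exact ((hp.coprime_iff_not_dvd.2 hpd).symm).dvd_of_dvd_mul_left hd

open Classical in
theorem cyc_D_not_dvd (p m : F[X]) (hp : Irreducible p) (hpm : p.Monic) (hm : m ≠ 0)
    (h : ¬ p ∣ m) :
    cycD (p * m) = cycD m ∪ (cycD m).image (fun d => p * d) := by
  ext d
  rw [Finset.mem_union, Finset.mem_image, cyc_mem_D _ _ (mul_ne_zero hp.ne_zero hm),
    cyc_mem_D _ _ hm]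
  constructor
  · rintro ⟨h1, h2, h3⟩
    by_cases hpd : p ∣ d
    · obtain ⟨e, rfl⟩ := hpd
      refine Or.inr ⟨e, ?_, rfl⟩
      rw [cyc_mem_D _ _ hm]
      exact ⟨hpm.of_mul_monic_left h1, h2.squarefree_of_dvd (dvd_mul_left _ _),
        (mul_dvd_mul_iff_left hp.ne_zero).1 h3⟩
    · exact Or.inl ⟨h1, h2, ((hp.coprime_iff_not_dvd.2 hpd).symm).dvd_of_dvd_mul_left h3⟩
  · rintro (⟨h1, h2, h3⟩ | ⟨e, he, rfl⟩)
    · exact ⟨h1, h2, h3.mul_left _⟩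
    · rw [cyc_mem_D _ _ hm] at he
      obtain ⟨h1, h2, h3⟩ := he
      refine ⟨hpm.mul h1, ?_, mul_dvd_mul_left _ h3⟩
      have hpe : IsCoprime p e := hp.coprime_iff_not_dvd.2 (fun hh => h (hh.trans h3))
      rw [squarefree_mul_iff]
      exact ⟨hpe.isRelPrime, hp.squarefree, h2⟩

theorem cyc_key (n : ℕ) : ∀ f : F[X], f.Monic → f.natDegree = n →
    (Fintype.card F : ℝ) ^ f.natDegree / cycPhi f = ∑ d ∈ cycD f, (1 : ℝ) / cycPhi d := by
  classical
  induction n using Nat.strong_induction_on with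
  | _ n ih =>
  intro f hf hn
  by_cases hu : IsUnit f
  · obtain rfl := hf.eq_one_of_isUnit hu
    have : cycD (1 : F[X]) = {1} := by
      ext d
      rw [cyc_mem_D _ _ one_ne_zero, Finset.mem_singleton]
      constructor
      · rintro ⟨h1, -, h3⟩
        exact h1.eq_one_of_isUnit (isUnit_of_dvd_one h3)
      · rintro rfl
        exact ⟨monic_one, squarefree_one, dvd_rfl⟩
    rw [this]
    simp [cyc_phi_one]
  · obtain ⟨p, hpm, hp, m, rfl⟩ := exists_monic_irreducible_factor f hu
    have hm : m.Monic := hpm.of_mul_monic_left hf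
    have hdeg := hpm.natDegree_mul hm
    have hlt : m.natDegree < n := by
      have := hp.natDegree_pos
      omega
    have IH := ih _ hlt m hm rfl
    have hphi : (cycPhi m : ℝ) ≠ 0 := by
      exact_mod_cast (cyc_phi_pos m hm.ne_zero).ne'
    have hphip : (cycPhi p : ℝ) ≠ 0 := by
      exact_mod_cast (cyc_phi_pos p hp.ne_zero).ne'
    have hq : (Fintype.card F : ℝ) ≠ 0 := by
      exact_mod_cast Fintype.card_ne_zero
    by_cases h : p ∣ m
    · rw [cyc_D_dvd p m hp hm.ne_zero h, ← IH, cyc_phi_dvd p m hp.ne_zero hm.ne_zero h, hdeg, pow_add]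
      push_cast
      field_simp
    · have hcop : IsCoprime p m := hp.coprime_iff_not_dvd.2 h
      rw [cyc_D_not_dvd p m hp hpm hm.ne_zero h, Finset.sum_union, Finset.sum_image]
      · have h2 : ∑ d ∈ cycD m, (1 : ℝ) / cycPhi (p * d) =
            (1 / cycPhi p) * ∑ d ∈ cycD m, (1 : ℝ) / cycPhi d := by
          rw [Finset.mul_sum]
          refine Finset.sum_congr rfl fun d hd => ?_
          rw [cyc_mem_D _ _ hm.ne_zero] at hd
          rw [cyc_phi_mul p d (hcop.of_isCoprime_of_dvd_right hd.2.2)]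
          push_cast
          field_simp
        rw [h2, ← IH, cyc_phi_mul p m hcop, hdeg, pow_add]
        have h3 : (cycPhi p : ℝ) + 1 = (Fintype.card F : ℝ) ^ p.natDegree := by
          exact_mod_cast cyc_phi_irr p hp
        rw [← h3]
        push_cast
        field_simp
      · intro a _ b _ hab
        exact mul_left_cancel₀ hp.ne_zero hab
      · rw [Finset.disjoint_left]
        intro d hd hd'
        obtain ⟨e, -, rfl⟩ := Finset.mem_image.1 hd'
        rw [cyc_mem_D _ _ hm.ne_zero] at hd
        exact h ((dvd_mul_right _ _).trans hd.2.2)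

open Classical in
theorem cyc_sum (n : ℕ) :
    ∑ f ∈ cycM F n, (Fintype.card F : ℝ) ^ n / cycPhi f =
      ∑ d ∈ (cycU F n).filter (fun d => Squarefree d),
        (1 : ℝ) / cycPhi d * (Fintype.card F : ℝ) ^ (n - d.natDegree) := by
  have h1 : ∀ f ∈ cycM F n, (Fintype.card F : ℝ) ^ n / cycPhi f =
      ∑ d ∈ (cycU F n).filter (fun d => Squarefree d),
        if d ∣ f then (1 : ℝ) / cycPhi d else 0 := by
    intro f hf
    rw [cyc_mem_M] at hf
    have := cyc_key n f hf.1 hf.2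
    rw [cycD, hf.2] at this
    rw [this, ← Finset.sum_filter, Finset.filter_filter]
  rw [Finset.sum_congr rfl h1, Finset.sum_comm]
  refine Finset.sum_congr rfl fun d hd => ?_
  rw [Finset.mem_filter, cyc_mem_U] at hd
  rw [← Finset.sum_filter, Finset.sum_const, cyc_card_multiples n d hd.1.1 hd.1.2]
  rw [nsmul_eq_mul, mul_comm]
  push_cast
  rfl

open Classical in
theorem cyc_rec (n : ℕ) :
    (Fintype.card F : ℝ) ^ (n + 1) * ∑ f ∈ cycM F (n + 1), (1 : ℝ) / cycPhi f =
      (Fintype.card F : ℝ) ^ (n + 1) * ∑ f ∈ cycM F n, (1 : ℝ) / cycPhi f +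
      ∑ f ∈ (cycM F (n + 1)).filter (fun d => Squarefree d), (1 : ℝ) / cycPhi f := by
  have h1 := cyc_sum (F := F) (n + 1)
  have h2 := cyc_sum (F := F) n
  have hU : cycU F (n + 1) = cycU F n ∪ cycM F (n + 1) := by
    ext p
    rw [Finset.mem_union, cyc_mem_U, cyc_mem_U, cyc_mem_M, Nat.le_succ_iff]
    tauto
  have hd : Disjoint ((cycU F n).filter (fun d => Squarefree d))
      ((cycM F (n + 1)).filter (fun d => Squarefree d)) := by
    apply Finset.disjoint_filter_filter
    rw [Finset.disjoint_left]
    intro p hp hp'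
    rw [cyc_mem_U] at hp
    rw [cyc_mem_M] at hp'
    omega
  rw [hU, Finset.filter_union, Finset.sum_union hd] at h1
  have h3 : ∀ k, ∑ f ∈ cycM F k, (Fintype.card F : ℝ) ^ k / cycPhi f =
      (Fintype.card F : ℝ) ^ k * ∑ f ∈ cycM F k, (1 : ℝ) / cycPhi f := by
    intro k
    rw [Finset.mul_sum]
    exact Finset.sum_congr rfl fun f _ => by ring
  rw [h3] at h1 h2
  rw [h1, pow_succ', mul_assoc, h2, Finset.mul_sum]
  congr 1
  · refine Finset.sum_congr rfl fun d hd => ?_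
    rw [Finset.mem_filter, cyc_mem_U] at hd
    rw [Nat.succ_sub hd.1.2, pow_succ]
    ring
  · refine Finset.sum_congr rfl fun d hd => ?_
    rw [Finset.mem_filter, cyc_mem_M] at hd
    rw [hd.1.2, Nat.sub_self, pow_zero, mul_one]

theorem cyc_count (n : ℕ) (P : F[X] → Prop) (s : Finset F[X])
    (hs : ∀ f, f ∈ s ↔ (f.Monic ∧ f.natDegree = n) ∧ P f) :
    (Nat.card {A : Matrix (Fin n) (Fin n) F // A.charpoly = minpoly F A ∧ P (minpoly F A)} : ℝ) =
      Nat.card (GL (Fin n) F) * ∑ f ∈ s, (1 : ℝ) / cycPhi f := by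
  classical
  have h1 : Nat.card {A : Matrix (Fin n) (Fin n) F // A.charpoly = minpoly F A ∧ P (minpoly F A)}
      = ∑ f ∈ s, Nat.card {A : Matrix (Fin n) (Fin n) F // minpoly F A = f} := by
    simp_rw [Nat.card_eq_fintype_card, Fintype.card_subtype]
    rw [Finset.card_eq_sum_card_fiberwise (f := fun A => minpoly F A) (t := s)]
    · refine Finset.sum_congr rfl fun f hf => ?_
      rw [hs] at hf
      congr 1
      ext A
      simp only [Finset.mem_filter, Finset.mem_univ, true_and]
      constructor
      · exact fun h => h.2
      · rintro rfl
        exact ⟨⟨(cyc_iff A).2 hf.1.2, hf.2⟩, rfl⟩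
    · intro A hA
      simp only [Finset.coe_filter, Finset.mem_univ, true_and, Set.mem_ofPred_eq] at hA
      rw [Finset.mem_coe, hs]
      exact ⟨⟨minpoly.monic (Matrix.isIntegral A), (cyc_iff A).1 hA.1⟩, hA.2⟩
  rw [h1, Finset.mul_sum]
  push_cast
  refine Finset.sum_congr rfl fun f hf => ?_
  rw [hs] at hf
  have hphi : (cycPhi f : ℝ) ≠ 0 := by
    exact_mod_cast (cyc_phi_pos f hf.1.1.ne_zero).ne'
  rw [← cyc_card_matrix n f hf.1.1 hf.1.2]
  push_cast
  field_simp

theorem cyc_card_GL_succ (n : ℕ) :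
    (Nat.card (GL (Fin (n + 1)) F) : ℝ) / (Fintype.card F : ℝ) ^ ((n + 1) ^ 2) *
      (Fintype.card F : ℝ) ^ (n + 1) =
    (Nat.card (GL (Fin n) F) : ℝ) / (Fintype.card F : ℝ) ^ (n ^ 2) *
      ((Fintype.card F : ℝ) ^ (n + 1) - 1) := by
  have hq : (Fintype.card F : ℝ) ≠ 0 := by
    exact_mod_cast Fintype.card_ne_zero
  have hq1 : 1 ≤ Fintype.card F := Fintype.card_pos
  have hG : ∀ k, (Nat.card (GL (Fin k) F) : ℝ) =
      (Fintype.card F : ℝ) ^ (k * k) * ∏ i ∈ Finset.range k, (1 - ((Fintype.card F : ℝ) ^ (i + 1))⁻¹) := by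
    intro k
    rw [Matrix.card_GL_field, Nat.cast_prod, Finset.prod_range, ← Equiv.prod_comp Fin.revPerm, pow_mul]
    have : ((Fintype.card F : ℝ) ^ k) ^ k = ∏ i : Fin k, (Fintype.card F : ℝ) ^ k := by simp
    rw [this, ← Finset.prod_mul_distrib]
    refine Finset.prod_congr rfl fun i _ => ?_
    rw [Nat.cast_sub (Nat.pow_le_pow_right hq1 (by omega))]
    push_cast
    have hk : k = (k - (i + 1)) + (i + 1) := by omega
    simp only [Fin.revPerm_apply, Fin.val_rev]
    have h2 : (Fintype.card F : ℝ) ^ k =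
      (Fintype.card F : ℝ) ^ (k - (i + 1 : ℕ)) * (Fintype.card F : ℝ) ^ (i + 1 : ℕ) := by
      rw [← pow_add, ← hk]
    rw [h2]
    field_simp
  rw [hG, hG, Finset.prod_range_succ, ← pow_two, ← pow_two]
  field_simp

end

/-- `c_M(n+1,q) − c_M(n,q) = (s_M(n+1,q) − c_M(n,q)) / q^{n+1}`. -/
theorem cyclic_separable_recurrence {F : Type} [Field F] [Fintype F] (q : ℕ)
    (hq : Fintype.card F = q) (n : ℕ) :
    cyclicProportion F (n + 1) - cyclicProportion F n =
      (separableProportion F (n + 1) - cyclicProportion F n) / (q : ℝ) ^ (n + 1) := by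
  classical
  subst hq
  have hq : (Fintype.card F : ℝ) ≠ 0 := by
    exact_mod_cast Fintype.card_ne_zero
  have hc : ∀ k, cyclicProportion F k = (Nat.card (GL (Fin k) F) : ℝ) /
      (Fintype.card F : ℝ) ^ (k ^ 2) * ∑ f ∈ cycM F k, (1 : ℝ) / cycPhi f := by
    intro k
    have := cyc_count (F := F) k (fun _ => True) (cycM F k) (by simp [cyc_mem_M])
    simp only [and_true] at this
    rw [cyclicProportion, this]
    ring
  have hs : ∀ k, separableProportion F k = (Nat.card (GL (Fin k) F) : ℝ) /
      (Fintype.card F : ℝ) ^ (k ^ 2) *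
        ∑ f ∈ (cycM F k).filter (fun d => Squarefree d), (1 : ℝ) / cycPhi f := by
    intro k
    have := cyc_count (F := F) k Squarefree ((cycM F k).filter (fun d => Squarefree d))
      (by simp [cyc_mem_M])
    have h2 : Nat.card {A : Matrix (Fin k) (Fin k) F // Squarefree A.charpoly} =
        Nat.card {A : Matrix (Fin k) (Fin k) F //
          A.charpoly = minpoly F A ∧ Squarefree (minpoly F A)} := by
      refine Nat.card_congr (Equiv.subtypeEquivRight fun A => ⟨fun h => ?_, fun h => ?_⟩)
      · have := cyc_of_squarefree A h
        exact ⟨this, this ▸ h⟩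
      · rw [h.1]; exact h.2
    rw [separableProportion, h2, this]
    ring
  rw [hc, hc, hs, eq_div_iff (pow_ne_zero _ hq)]
  have h1 := cyc_rec (F := F) n
  have h2 := cyc_card_GL_succ (F := F) n
  generalize (Nat.card (GL (Fin n) F) : ℝ) / (Fintype.card F : ℝ) ^ (n ^ 2) = g at *
  generalize (Nat.card (GL (Fin (n + 1)) F) : ℝ) / (Fintype.card F : ℝ) ^ ((n + 1) ^ 2) = g' at *
  linear_combination g' * h1 + (∑ f ∈ cycM F n, (1 : ℝ) / cycPhi f) * h2
end

section
/- Let F_q be a finite field with q elements, let c_M(n,q) be the proportion of n×n matrices over F_q whose characteristic polynomial equals the minimal polynomial, and let c_M(∞,q) = (1 − q^{−5}) ∏_{r=3}^∞ (1 − q^{−r}). Then for every n ≥ 1, 0 < |c_M(n,q) − c_M(∞,q)| < 1/(q^{n+1}(1 − 1/q)). -/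
open Polynomial

theorem cyc_vec_dvd {F V : Type*} [Field F] [AddCommGroup V] [Module F V] [FiniteDimensional F V]
    (T : Module.End F V) (g : F[X]) : g ∣ minpoly F T → 
    ∃ v : V, ∀ r : F[X], aeval T r v = 0 ↔ g ∣ r := by
  classical
  have hTint : IsIntegral F T := Algebra.IsIntegral.isIntegral T
  have hne := minpoly.ne_zero hTint
  induction g using UniqueFactorizationMonoid.induction_on_coprime with
  | h0 => intro h; exact absurd (zero_dvd_iff.1 h) hne
  | h1 hx => intro _; exact ⟨0, fun r => by simp [hx.dvd]⟩
  | @hpr p i hp =>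
    rintro ⟨k, hk⟩
    rcases i with _ | i
    · exact ⟨0, fun r => by simp⟩
    have h1 : aeval T (p ^ i * k) ≠ 0 := by
      intro h0
      have := minpoly.dvd F T h0
      rw [hk, pow_succ, mul_assoc] at this
      obtain ⟨c, hc⟩ := this
      have hpk : p ^ i * k ≠ 0 := by
        rintro h; apply hne; rw [hk, pow_succ, mul_right_comm, h, zero_mul]
      have h2 : (p ^ i * k) * (p * c) = (p ^ i * k) * 1 := by rw [mul_one]; nth_rw 2 [hc]; ring
      have h3 := mul_left_cancel₀ hpk h2
      exact hp.not_isUnit (IsUnit.of_mul_eq_one _ h3)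
    obtain ⟨w, hw⟩ : ∃ w, aeval T (p ^ i * k) w ≠ 0 := by
      by_contra hcon; push Not at hcon
      exact h1 (LinearMap.ext hcon)
    refine ⟨aeval T k w, fun r => ⟨fun hr => ?_, ?_⟩⟩
    · have hd := EuclideanDomain.gcd_dvd_left (p ^ (i+1)) r
      obtain ⟨j, hj, hass⟩ := (dvd_prime_pow hp _).1 hd
      have hkill : aeval T (p ^ (i+1)) (aeval T k w) = 0 := by
        rw [← Module.End.mul_apply, ← map_mul, ← hk, minpoly.aeval]; rfl
      have hg : aeval T (EuclideanDomain.gcd (p ^ (i+1)) r) (aeval T k w) = 0 := by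
        rw [EuclideanDomain.gcd_eq_gcd_ab, mul_comm _ (EuclideanDomain.gcdA _ _),
          mul_comm _ (EuclideanDomain.gcdB _ _), map_add, map_mul, map_mul, LinearMap.add_apply,
          Module.End.mul_apply, Module.End.mul_apply, hkill, hr, map_zero, map_zero, add_zero]
      by_cases hji : j = i + 1
      · subst hji
        exact hass.symm.dvd.trans (EuclideanDomain.gcd_dvd_right _ _)
      · exfalso
        obtain ⟨c, hc⟩ := hass.dvd.trans (pow_dvd_pow p (show j ≤ i by omega))
        apply hw
        rw [map_mul, Module.End.mul_apply, hc, mul_comm, map_mul, Module.End.mul_apply, hg, map_zero]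
    · rintro ⟨c, rfl⟩
      rw [← Module.End.mul_apply, ← map_mul, mul_right_comm, ← hk, map_mul, minpoly.aeval, zero_mul]; rfl
  | @hcp x y hrel hx hy =>
    intro hxy
    obtain ⟨a, ha⟩ := hx ((dvd_mul_right _ _).trans hxy)
    obtain ⟨b, hb⟩ := hy ((dvd_mul_left _ _).trans hxy)
    have hcop : IsCoprime x y := hrel.isCoprime
    refine ⟨a + b, fun r => ⟨fun h => ?_, fun h => ?_⟩⟩
    · have e1 : aeval T (y * r) (a + b) = 0 := by rw [map_mul, Module.End.mul_apply, h, map_zero]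
      have e2 : aeval T (x * r) (a + b) = 0 := by rw [map_mul, Module.End.mul_apply, h, map_zero]
      rw [map_add, (hb _).2 (dvd_mul_right _ _), add_zero, ha] at e1
      rw [map_add, (ha _).2 (dvd_mul_right _ _), zero_add, hb] at e2
      exact hcop.mul_dvd (hcop.dvd_of_dvd_mul_left e1) (hcop.symm.dvd_of_dvd_mul_left e2)
    · rw [map_add, (ha _).2 ((dvd_mul_right _ _).trans h), (hb _).2 ((dvd_mul_left _ _).trans h), add_zero]

theorem cyc_vec {F V : Type*} [Field F] [AddCommGroup V] [Module F V] [FiniteDimensional F V]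
    (T : Module.End F V) : ∃ v : V, ∀ r : F[X], aeval T r v = 0 ↔ minpoly F T ∣ r := 
  cyc_vec_dvd T _ dvd_rfl

theorem card_minpoly_eq {F V : Type*} [Field F] [Finite F] [AddCommGroup V] [Module F V]
    [FiniteDimensional F V] (f : F[X]) (hf : f.Monic) (hd : f.natDegree = Module.finrank F V) :
    Nat.card {T : Module.End F V // minpoly F T = f} * Nat.card (AdjoinRoot f)ˣ
      = Nat.card (V ≃ₗ[F] V) := by
  have : Module.Finite F (AdjoinRoot f) := hf.finite_adjoinRoot
  have hfr : Module.finrank F (AdjoinRoot f) = Module.finrank F V := by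
    rw [(AdjoinRoot.powerBasis' hf).finrank, AdjoinRoot.powerBasis'_dim, hd]
  let e0 : AdjoinRoot f ≃ₗ[F] V := LinearEquiv.ofFinrankEq _ _ hfr
  have h1 : Nat.card (V ≃ₗ[F] V) = Nat.card (AdjoinRoot f ≃ₗ[F] V) :=
    Nat.card_congr ⟨fun e => e0.trans e, fun e => e0.symm.trans e, fun e => by ext; simp,
      fun e => by ext; simp⟩
  rw [h1]
  let ρ : Module.End F (AdjoinRoot f) := Algebra.lmul F (AdjoinRoot f) (AdjoinRoot.root f)
  have hρ : ∀ p : F[X], aeval ρ p = Algebra.lmul F (AdjoinRoot f) (AdjoinRoot.mk f p) := by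
    intro p
    rw [Polynomial.aeval_algHom_apply, AdjoinRoot.aeval_eq]
  have hmin : ∀ e : AdjoinRoot f ≃ₗ[F] V, minpoly F (e.conj ρ) = f := by
    intro e
    have : e.conj ρ = e.conjAlgEquiv F ρ := rfl
    rw [this, minpoly.algEquiv_eq]
    rw [minpoly.algHom_eq (Algebra.lmul F (AdjoinRoot f)) Algebra.lmul_injective, 
      AdjoinRoot.minpoly_root hf.ne_zero, hf.leadingCoeff]
    simp
  let Ψ : (AdjoinRoot f ≃ₗ[F] V) → {T : Module.End F V // minpoly F T = f} :=
    fun e => ⟨e.conj ρ, hmin e⟩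
  have hsurj : Function.Surjective Ψ := by
    rintro ⟨T, hT⟩
    obtain ⟨v, hv⟩ := cyc_vec T
    rw [hT] at hv
    let L0 : F[X] →ₗ[F] V := (LinearMap.applyₗ v).comp (aeval T).toLinearMap
    have hL0 : ∀ r, L0 r = aeval T r v := fun r => rfl
    let L : AdjoinRoot f →ₗ[F] V := 
      { toFun := fun x => Quotient.liftOn' x (fun r => aeval T r v) (by
          intro a b hab
          have : f ∣ b - a := by
            have := (QuotientAddGroup.leftRel_apply.1 hab)
            have := Ideal.mem_span_singleton.1 this
            rwa [neg_add_eq_sub] at this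
          have := (hv _).2 this
          rw [map_sub, LinearMap.sub_apply, sub_eq_zero] at this
          exact this.symm)
        map_add' := by
          intro x y
          obtain ⟨x, rfl⟩ := AdjoinRoot.mk_surjective x
          obtain ⟨y, rfl⟩ := AdjoinRoot.mk_surjective y
          rw [← map_add]
          change aeval T (x + y) v = aeval T x v + aeval T y v
          simp
        map_smul' := by
          intro c x
          obtain ⟨x, rfl⟩ := AdjoinRoot.mk_surjective x
          rw [AdjoinRoot.smul_mk]
          change aeval T (c • x) v = c • aeval T x v
          simp }
    have hL : ∀ r, L (AdjoinRoot.mk f r) = aeval T r v := fun r => rfl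
    have hinj : Function.Injective L := by
      rw [injective_iff_map_eq_zero]
      intro x hx
      obtain ⟨x, rfl⟩ := AdjoinRoot.mk_surjective x
      rw [hL, hv] at hx
      exact AdjoinRoot.mk_eq_zero.2 hx
    refine ⟨LinearEquiv.ofInjectiveOfFinrankEq L hinj hfr, ?_⟩
    apply Subtype.ext
    apply LinearMap.ext
    intro w
    obtain ⟨x, rfl⟩ := (LinearEquiv.ofInjectiveOfFinrankEq L hinj hfr).surjective w
    obtain ⟨x, rfl⟩ := AdjoinRoot.mk_surjective x
    change (LinearEquiv.ofInjectiveOfFinrankEq L hinj hfr).conj ρ _ = T _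
    rw [LinearEquiv.conj_apply_apply, LinearEquiv.symm_apply_apply]
    change L (AdjoinRoot.root f * AdjoinRoot.mk f x) = T (L (AdjoinRoot.mk f x))
    rw [← AdjoinRoot.mk_X, ← map_mul, hL, hL]
    simp
  have hfib : ∀ T, Nonempty ({e // Ψ e = T} ≃ (AdjoinRoot f)ˣ) := by
    intro T
    obtain ⟨e, he⟩ := hsurj T
    subst he
    let m : (AdjoinRoot f)ˣ → (AdjoinRoot f ≃ₗ[F] AdjoinRoot f) := fun u =>
      { toFun := fun x => x * u
        invFun := fun x => x * (u⁻¹ : (AdjoinRoot f)ˣ)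
        map_add' := fun x y => add_mul _ _ _
        map_smul' := fun c x => smul_mul_assoc _ _ _
        left_inv := fun x => by simp
        right_inv := fun x => by simp }
    have hm : ∀ u x, m u x = x * u := fun u x => rfl
    have hms : ∀ u x, (m u).symm x = x * (u⁻¹ : (AdjoinRoot f)ˣ) := fun u x => rfl
    have hρa : ∀ x, ρ x = AdjoinRoot.root f * x := fun x => rfl
    refine ⟨Equiv.symm (Equiv.ofBijective (fun u => ⟨(m u).trans e, ?_⟩) ⟨?_, ?_⟩)⟩
    · apply Subtype.ext
      apply LinearMap.ext
      intro w
      change ((m u).trans e).conj ρ w = e.conj ρ w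
      simp only [LinearEquiv.conj_apply_apply, LinearEquiv.trans_apply, LinearEquiv.trans_symm, hms,
        hm, hρa]
      rw [mul_assoc, mul_assoc, Units.inv_mul, mul_one]
    · intro u u' h
      have := congrArg (fun z => z.1 1) h
      simp only [LinearEquiv.trans_apply, hm, one_mul] at this
      exact Units.ext (e.injective this)
    · rintro ⟨e', he'⟩
      have hc : ∀ x, e.symm (e' (AdjoinRoot.root f * x)) = AdjoinRoot.root f * e.symm (e' x) := by
        intro x
        have h2 : e'.conj ρ = e.conj ρ := congrArg Subtype.val he'
        have h3 := congrArg (fun z => z (e' x)) h2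
        simp only [LinearEquiv.conj_apply_apply, LinearEquiv.symm_apply_apply, hρa] at h3
        rw [h3, LinearEquiv.symm_apply_apply]
      have hall : ∀ p : F[X], e.symm (e' (AdjoinRoot.mk f p)) = AdjoinRoot.mk f p * e.symm (e' 1) := by
        intro p
        induction p using Polynomial.induction_on' with
        | add p q hp hq => rw [map_add, map_add, map_add, hp, hq, add_mul]
        | monomial k a =>
          have hk : ∀ k, e.symm (e' (AdjoinRoot.root f ^ k)) = AdjoinRoot.root f ^ k * e.symm (e' 1) := by
            intro k
            induction k with
            | zero => simp
            | succ k ih => rw [pow_succ', hc, ih, mul_assoc]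
          rw [← Polynomial.smul_X_eq_monomial, ← AdjoinRoot.smul_mk, map_pow, AdjoinRoot.mk_X, map_smul,
            map_smul, hk, smul_mul_assoc]
      obtain ⟨x, hx⟩ := e'.surjective (e 1)
      obtain ⟨p, rfl⟩ := AdjoinRoot.mk_surjective x
      have hu : AdjoinRoot.mk f p * e.symm (e' 1) = 1 := by
        rw [← hall, hx, LinearEquiv.symm_apply_apply]
      refine ⟨⟨e.symm (e' 1), AdjoinRoot.mk f p, by rw [mul_comm, hu], hu⟩, ?_⟩
      apply Subtype.ext
      apply LinearEquiv.ext
      intro x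
      obtain ⟨x, rfl⟩ := AdjoinRoot.mk_surjective x
      rw [LinearEquiv.trans_apply, hm, ← hall, LinearEquiv.apply_symm_apply]
  rw [← Nat.card_prod, Nat.card_congr (Equiv.sigmaFiberEquiv Ψ).symm]
  symm
  exact Nat.card_congr ((Equiv.sigmaCongrRight fun T => (hfib T).some).trans (Equiv.sigmaEquivProd _ _))

/-- The totient function for polynomials -/
noncomputable def Phi {F : Type*} [Field F] (f : F[X]) : ℕ := Nat.card (AdjoinRoot f)ˣ

noncomputable def monEquiv (F : Type*) [Field F] (n : ℕ) :
    {f : F[X] // f.Monic ∧ f.natDegree = n} ≃ degreeLT F n where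
  toFun f := ⟨f.1 - X ^ n, by
    rw [mem_degreeLT]
    have hd : f.1.degree = n := by rw [degree_eq_natDegree f.2.1.ne_zero, f.2.2]
    rw [← hd]
    apply degree_sub_lt_left
    · rw [hd, degree_X_pow]
    · exact f.2.1.ne_zero
    · rw [f.2.1.leadingCoeff, (monic_X_pow n).leadingCoeff]⟩
  invFun g := ⟨X ^ n + g.1, monic_X_pow_add (mem_degreeLT.1 g.2), by
    rw [natDegree_add_eq_left_of_degree_lt, natDegree_X_pow]
    rw [degree_X_pow]; exact mem_degreeLT.1 g.2⟩
  left_inv f := by ext; simp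
  right_inv g := by ext; simp

theorem mon_finite (F : Type*) [Field F] [Finite F] (n : ℕ) :
    {f : F[X] | f.Monic ∧ f.natDegree = n}.Finite := by
  have : Finite (degreeLT F n) := Finite.of_equiv _ (degreeLTEquiv F n).symm.toEquiv
  exact Finite.of_equiv _ (monEquiv F n).symm

noncomputable def MonD (F : Type*) [Field F] [Finite F] (n : ℕ) : Finset F[X] :=
  (mon_finite F n).toFinset

theorem mem_MonD {F : Type*} [Field F] [Finite F] {n : ℕ} {f : F[X]} :
    f ∈ MonD F n ↔ f.Monic ∧ f.natDegree = n := by simp [MonD]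

theorem card_MonD (F : Type*) [Field F] [Finite F] (n : ℕ) : (MonD F n).card = Nat.card F ^ n := by
  rw [MonD, ← Set.ncard_eq_toFinset_card _ (mon_finite F n), ← Nat.card_coe_set_eq]
  have := Nat.card_congr ((monEquiv F n).trans (degreeLTEquiv F n).toEquiv)
  rw [Nat.card_fun] at this
  rw [Nat.card_fin] at this
  exact this

theorem card_adjoinRoot {F : Type*} [Field F] [Finite F] {f : F[X]} (hf : f.Monic) :
    Nat.card (AdjoinRoot f) = Nat.card F ^ f.natDegree := by
  have : Module.Finite F (AdjoinRoot f) := hf.finite_adjoinRoot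
  rw [Module.natCard_eq_pow_finrank (K := F), (AdjoinRoot.powerBasis' hf).finrank, AdjoinRoot.powerBasis'_dim]

theorem finite_adjoinRoot {F : Type*} [Field F] [Finite F] {f : F[X]} (hf : f.Monic) :
    Finite (AdjoinRoot f) := by
  have : Module.Finite F (AdjoinRoot f) := hf.finite_adjoinRoot
  exact Module.finite_of_finite F

theorem Phi_pos {F : Type*} [Field F] [Finite F] {f : F[X]} (hf : f.Monic) : 0 < Phi f := by
  have := finite_adjoinRoot hf
  exact Nat.card_pos

noncomputable def om (q : ℝ) (n : ℕ) : ℝ := ∏ i ∈ Finset.range n, (1 - q⁻¹ ^ (i + 1))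

theorem card_GL_eq {F : Type*} [Field F] [Fintype F] (n : ℕ) :
    (Nat.card ((Fin n → F) ≃ₗ[F] (Fin n → F)) : ℝ) = 
      (Fintype.card F : ℝ) ^ (n ^ 2) * om (Fintype.card F) n := by
  have e1 : Nat.card ((Fin n → F) ≃ₗ[F] (Fin n → F)) = Nat.card (GL (Fin n) F) :=
    Nat.card_congr ((LinearMap.GeneralLinearGroup.generalLinearEquiv F (Fin n → F)).symm.toEquiv.trans
      Matrix.GeneralLinearGroup.toLin.symm.toEquiv)
  rw [e1, Matrix.card_GL_field, Nat.cast_prod, Finset.prod_fin_eq_prod_range, om]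
  have hq : (0:ℝ) < Fintype.card F := by exact_mod_cast Fintype.card_pos
  have h1 : 1 ≤ Fintype.card F := Fintype.card_pos
  rw [sq, pow_mul, ← Finset.prod_range_reflect (fun i => 1 - (Fintype.card F : ℝ)⁻¹ ^ (i+1))]
  have hc : ((Fintype.card F : ℝ) ^ n) ^ n = ∏ _i ∈ Finset.range n, (Fintype.card F : ℝ) ^ n := by
    rw [Finset.prod_const, Finset.card_range]
  rw [hc, ← Finset.prod_mul_distrib]
  apply Finset.prod_congr rfl
  intro i hi
  have hi := Finset.mem_range.1 hi
  rw [dif_pos hi, Nat.cast_sub (Nat.pow_le_pow_right h1 hi.le)]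
  push_cast
  have : n - 1 - i + 1 = n - i := by omega
  rw [this, mul_sub, mul_one, inv_pow, ← pow_sub₀ _ hq.ne' (by omega)]
  congr 2
  omega

noncomputable def SS (F : Type*) [Field F] [Finite F] (n : ℕ) : ℝ := ∑ f ∈ MonD F n, (1:ℝ) / Phi f

theorem charpoly_eq_minpoly_iff {F : Type*} [Field F] {n : ℕ} (A : Matrix (Fin n) (Fin n) F) :
    A.charpoly = minpoly F A ↔ (minpoly F A).Monic ∧ (minpoly F A).natDegree = n := by
  have hm : (minpoly F A).Monic := minpoly.monic (Algebra.IsIntegral.isIntegral A)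
  constructor
  · intro h
    refine ⟨hm, ?_⟩
    rw [← h, Matrix.charpoly_natDegree_eq_dim, Fintype.card_fin]
  · rintro ⟨-, h⟩
    refine eq_of_monic_of_dvd_of_natDegree_le hm A.charpoly_monic A.minpoly_dvd_charpoly ?_ 
    rw [Matrix.charpoly_natDegree_eq_dim, Fintype.card_fin, h]

theorem cyc_eq (F : Type) [Field F] [Fintype F] (n : ℕ) :
    cyclicProportion F n = om (Fintype.card F) n * SS F n := by
  classical
  have hq : (0:ℝ) < Fintype.card F := by exact_mod_cast Fintype.card_pos
  rw [cyclicProportion, div_eq_iff (by positivity), mul_comm, ← mul_assoc, ← card_GL_eq, SS, Finset.mul_sum]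
  have h1 : Nat.card {A : Matrix (Fin n) (Fin n) F // A.charpoly = minpoly F A} = 
      ∑ f ∈ MonD F n, Nat.card {T : Module.End F (Fin n → F) // minpoly F T = f} := by
    have h2 : ∀ f : F[X], Nat.card {T : Module.End F (Fin n → F) // minpoly F T = f} = 
       (Finset.univ.filter (fun A : Matrix (Fin n) (Fin n) F => minpoly F A = f)).card := by
      intro f
      rw [← Fintype.card_subtype, ← Nat.card_eq_fintype_card]
      symm
      apply Nat.card_congr
      exact Equiv.subtypeEquiv (Matrix.toLin' (R := F) (m := Fin n) (n := Fin n)).toEquiv (by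
        intro A
        change _ ↔ minpoly F (Matrix.toLin' A) = f
        rw [Matrix.minpoly_toLin'])
    simp_rw [h2]
    rw [Nat.card_eq_fintype_card, Fintype.card_subtype, Finset.card_eq_sum_card_fiberwise (f := minpoly F) (t := MonD F n)]
    · apply Finset.sum_congr rfl
      intro f hf
      congr 1
      ext A
      simp only [Finset.mem_filter, Finset.mem_univ, true_and, and_iff_right_iff_imp]
      rintro rfl
      exact (charpoly_eq_minpoly_iff A).2 (mem_MonD.1 hf)
    · intro A hA
      exact mem_MonD.2 ((charpoly_eq_minpoly_iff A).1 (by simpa using hA))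
  rw [h1, Nat.cast_sum]
  apply Finset.sum_congr rfl
  intro f hf
  obtain ⟨hm, hd⟩ := mem_MonD.1 hf
  have := card_minpoly_eq (V := Fin n → F) f hm (by simp [hd])
  rw [← this]
  have hp : (Phi f : ℝ) ≠ 0 := by exact_mod_cast (Phi_pos hm).ne'
  push_cast
  change _ = _ * (Phi f : ℝ) * _
  field_simp

theorem isUnit_mk_iff {F : Type*} [Field F] (f g : F[X]) :
    IsUnit (AdjoinRoot.mk f g) ↔ IsCoprime f g := by
  constructor
  · intro h
    obtain ⟨b, hb⟩ := h.exists_right_inv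
    obtain ⟨b, rfl⟩ := AdjoinRoot.mk_surjective b
    rw [← map_mul, ← map_one (AdjoinRoot.mk f), AdjoinRoot.mk_eq_mk] at hb
    obtain ⟨c, hc⟩ := hb
    exact ⟨-c, b, by linear_combination hc⟩
  · rintro ⟨a, b, h⟩
    apply IsUnit.of_mul_eq_one (AdjoinRoot.mk f b)
    rw [← map_mul, ← map_one (AdjoinRoot.mk f), AdjoinRoot.mk_eq_mk]
    exact ⟨-a, by linear_combination h⟩

theorem Phi_eq_card {F : Type*} [Field F] (f : F[X]) :
    Phi f = Nat.card {x : AdjoinRoot f // IsUnit x} :=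
  Nat.card_congr (Equiv.ofBijective (fun u => ⟨u.1, u.isUnit⟩)
    ⟨fun _ _ h => Units.ext (congrArg Subtype.val h), fun ⟨_, hx⟩ => ⟨hx.unit, rfl⟩⟩)

theorem Phi_mul_of_dvd {F : Type*} [Field F] [Finite F] {p f : F[X]} (hp : p.Monic) (hf : f.Monic)
    (h : p ∣ f) : Phi (p * f) = Nat.card F ^ p.natDegree * Phi f := by
  have hpf := hp.mul hf
  have := finite_adjoinRoot hpf
  have := finite_adjoinRoot hf
  let π : AdjoinRoot (p * f) →+* AdjoinRoot f := 
    Ideal.Quotient.factor (by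
      rw [Ideal.span_singleton_le_span_singleton]
      exact dvd_mul_left _ _)
  have hπ : ∀ g, π (AdjoinRoot.mk (p * f) g) = AdjoinRoot.mk f g := fun g => rfl
  have hs : Function.Surjective π := by
    intro x
    obtain ⟨x, rfl⟩ := AdjoinRoot.mk_surjective x
    exact ⟨_, hπ x⟩
  have hunit : ∀ x, IsUnit x ↔ IsUnit (π x) := by
    intro x
    obtain ⟨x, rfl⟩ := AdjoinRoot.mk_surjective x
    rw [hπ, isUnit_mk_iff, isUnit_mk_iff, IsCoprime.mul_left_iff]
    exact ⟨fun h => h.2, fun h' => ⟨h'.of_isCoprime_of_dvd_left h, h'⟩⟩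
  obtain ⟨s, hs⟩ := hs.hasRightInverse
  let E : AdjoinRoot (p * f) ≃ AdjoinRoot f × {x // π x = 0} := 
    { toFun := fun x => (π x, ⟨x - s (π x), by rw [map_sub, hs, sub_self]⟩)
      invFun := fun y => s y.1 + y.2.1
      left_inv := fun x => by simp
      right_inv := fun y => by
        have h1 : π (s y.1 + y.2.1) = y.1 := by rw [map_add, hs, y.2.2, add_zero]
        ext
        · exact h1
        · simp [h1] }
  have c1 := Nat.card_congr E
  rw [Nat.card_prod, card_adjoinRoot hpf, card_adjoinRoot hf, hp.natDegree_mul hf, pow_add, mul_comm] at c1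
  have hpos : 0 < Nat.card F ^ f.natDegree := pow_pos Nat.card_pos _
  have c2 := Nat.eq_of_mul_eq_mul_left hpos c1
  rw [c2, Phi_eq_card, Phi_eq_card, mul_comm (Nat.card {x // π x = 0}), ← Nat.card_prod]
  refine Nat.card_congr ((Equiv.subtypeEquiv E (q := fun y => IsUnit y.1) (fun x => hunit x)).trans ?_)
  exact ⟨fun y => (⟨y.1.1, y.2⟩, y.1.2), fun y => ⟨(y.1.1, y.2), y.1.2⟩, fun y => rfl, fun y => rfl⟩

theorem Phi_irred {F : Type*} [Field F] [Finite F] {p : F[X]} (hp : p.Monic) 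
    (hi : Irreducible p) : Phi p = Nat.card F ^ p.natDegree - 1 := by
  have := finite_adjoinRoot hp
  have : Fact (Irreducible p) := ⟨hi⟩
  rw [Phi, Nat.card_units, card_adjoinRoot hp]

theorem Phi_mul_of_not_dvd {F : Type*} [Field F] [Finite F] {p f : F[X]} (hp : p.Monic) (hi : Irreducible p)
    (h : ¬ p ∣ f) : Phi (p * f) = (Nat.card F ^ p.natDegree - 1) * Phi f := by
  rw [← Phi_irred hp hi]
  have hc : IsCoprime p f := (hi.coprime_iff_not_dvd).2 h
  unfold Phi
  rw [← Nat.card_prod]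
  have hc' : IsCoprime (Ideal.span {p}) (Ideal.span {f}) := (Ideal.isCoprime_span_singleton_iff _ _).2 hc
  have e1 : Ideal.span {p * f} = Ideal.span {p} * Ideal.span {f} := by rw [Ideal.span_singleton_mul_span_singleton]
  let e : AdjoinRoot (p * f) ≃+* AdjoinRoot p × AdjoinRoot f :=
    (Ideal.quotEquivOfEq e1).trans (Ideal.quotientMulEquivQuotientProd _ _ hc')
  exact Nat.card_congr ((Units.mapEquiv e.toMulEquiv).toEquiv.trans MulEquiv.prodUnits.toEquiv)

theorem Phi_one {F : Type*} [Field F] [Finite F] : Phi (1 : F[X]) = 1 := by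
  have h1 := card_adjoinRoot (F := F) monic_one
  rw [natDegree_one, pow_zero] at h1
  have := (Nat.card_eq_one_iff_unique.1 h1).1
  exact Nat.card_unique

open scoped Classical in
noncomputable def SD {F : Type*} [Field F] [Finite F] (f : F[X]) : Finset F[X] :=
  ((Finset.range (f.natDegree + 1)).biUnion (MonD F)).filter (fun m => m ∣ f ∧ Squarefree m)

theorem mem_SD {F : Type*} [Field F] [Finite F] {f : F[X]} (hf : f.Monic) {m : F[X]} :
    m ∈ SD f ↔ m.Monic ∧ m ∣ f ∧ Squarefree m := by
  simp only [SD, Finset.mem_filter, Finset.mem_biUnion, Finset.mem_range, mem_MonD]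
  constructor
  · rintro ⟨⟨k, hk, h1, h2⟩, h3⟩; exact ⟨h1, h3⟩
  · rintro ⟨h1, h3⟩
    exact ⟨⟨_, Nat.lt_succ_of_le (natDegree_le_of_dvd h3.1 hf.ne_zero), h1, rfl⟩, h3⟩

theorem not_dvd_of_sqfree {F : Type*} [Field F] {p m : F[X]} (hi : Irreducible p)
    (h : Squarefree (p * m)) : ¬ p ∣ m := by
  intro hd
  exact hi.not_isUnit (h p (mul_dvd_mul_left p hd))

theorem sqfree_mul {F : Type*} [Field F] {p m : F[X]} (hi : Irreducible p)
    (h : Squarefree m) (hp : ¬ p ∣ m) : Squarefree (p * m) := by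
  have hc : IsCoprime p m := (hi.coprime_iff_not_dvd).2 hp
  exact (squarefree_mul_iff).2 ⟨hc.isRelPrime, hi.squarefree, h⟩

theorem sum_SD {F : Type*} [Field F] [Finite F] (N : ℕ) : ∀ f : F[X], f.Monic → f.natDegree = N →
    ((Nat.card F : ℝ) ^ f.natDegree) / Phi f = ∑ m ∈ SD f, (1:ℝ) / Phi m := by
  classical
  induction N using Nat.strong_induction_on with
  | _ N ih =>
  intro f hf hN
  by_cases hu : IsUnit f
  · have h1 : f = 1 := hf.eq_one_of_isUnit hu
    subst h1
    have : SD (1 : F[X]) = {1} := by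
      ext m
      rw [mem_SD monic_one, Finset.mem_singleton]
      constructor
      · rintro ⟨h1, h2, h3⟩; exact h1.eq_one_of_isUnit (isUnit_of_dvd_one h2)
      · rintro rfl; exact ⟨monic_one, dvd_rfl, squarefree_one⟩
    rw [this]
    simp
  obtain ⟨p, hp, hi, f', rfl⟩ := Polynomial.exists_monic_irreducible_factor f hu
  have hf' : f'.Monic := hp.of_mul_monic_left hf
  have hdp : 0 < p.natDegree := hi.natDegree_pos
  have hlt : f'.natDegree < N := by rw [← hN, hp.natDegree_mul hf']; omega
  have IH := ih _ hlt f' hf' rfl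
  have hq : (1:ℝ) < Nat.card F := by exact_mod_cast Finite.one_lt_card
  have hph : (Phi f' : ℝ) ≠ 0 := by exact_mod_cast (Phi_pos hf').ne'
  by_cases hd : p ∣ f'
  · have : SD (p * f') = SD f' := by
      ext m
      rw [mem_SD hf, mem_SD hf']
      constructor
      · rintro ⟨h1, h2, h3⟩
        refine ⟨h1, ?_, h3⟩
        by_cases hpm : p ∣ m
        · obtain ⟨m', rfl⟩ := hpm
          have hc : IsCoprime p m' := (hi.coprime_iff_not_dvd).2 (not_dvd_of_sqfree hi h3)
          exact hc.mul_dvd hd ((mul_dvd_mul_iff_left hp.ne_zero).1 h2)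
        · have hc : IsCoprime p m := (hi.coprime_iff_not_dvd).2 hpm
          exact hc.symm.dvd_of_dvd_mul_left h2
      · rintro ⟨h1, h2, h3⟩
        exact ⟨h1, h2.trans (dvd_mul_left _ _), h3⟩
    rw [this, ← IH, Phi_mul_of_dvd hp hf' hd, hp.natDegree_mul hf']
    push_cast
    rw [pow_add]
    field_simp
  · have : SD (p * f') = SD f' ∪ (SD f').image (fun m => p * m) := by
      ext m
      rw [mem_SD hf, Finset.mem_union, mem_SD hf', Finset.mem_image]
      simp_rw [mem_SD hf']
      constructor
      · rintro ⟨h1, h2, h3⟩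
        by_cases hpm : p ∣ m
        · right
          obtain ⟨m', rfl⟩ := hpm
          exact ⟨m', ⟨hp.of_mul_monic_left h1, (mul_dvd_mul_iff_left hp.ne_zero).1 h2,
            h3.squarefree_of_dvd (dvd_mul_left _ _)⟩, rfl⟩
        · left
          have hc : IsCoprime p m := (hi.coprime_iff_not_dvd).2 hpm
          exact ⟨h1, hc.symm.dvd_of_dvd_mul_left h2, h3⟩
      · rintro (⟨h1, h2, h3⟩ | ⟨m', ⟨h1, h2, h3⟩, rfl⟩)
        · exact ⟨h1, h2.trans (dvd_mul_left _ _), h3⟩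
        · exact ⟨hp.mul h1, mul_dvd_mul_left _ h2, sqfree_mul hi h3 (fun h => hd (h.trans h2))⟩
    have hdis : Disjoint (SD f') ((SD f').image (fun m => p * m)) := by
      rw [Finset.disjoint_left]
      intro m hm hm'
      obtain ⟨m', -, rfl⟩ := Finset.mem_image.1 hm'
      exact hd ((dvd_mul_right _ _).trans ((mem_SD hf').1 hm).2.1)
    rw [this, Finset.sum_union hdis, Finset.sum_image (fun a _ b _ h => mul_left_cancel₀ hp.ne_zero h)]
    have hx : (1:ℝ) < (Nat.card F : ℝ) ^ p.natDegree := one_lt_pow₀ hq hdp.ne'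
    have hx' : 1 ≤ Nat.card F ^ p.natDegree := Nat.one_le_pow _ _ Nat.card_pos
    have : ∑ m ∈ SD f', (1:ℝ) / Phi (p * m) = ((Nat.card F : ℝ) ^ p.natDegree - 1)⁻¹ * ∑ m ∈ SD f', (1:ℝ) / Phi m := by
      rw [Finset.mul_sum]
      apply Finset.sum_congr rfl
      intro m hm
      rw [Phi_mul_of_not_dvd hp hi (fun h => hd (h.trans ((mem_SD hf').1 hm).2.1))]
      push_cast [Nat.cast_sub hx']
      rw [one_div, mul_inv, one_div]
    rw [this, ← IH, Phi_mul_of_not_dvd hp hi hd, hp.natDegree_mul hf']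
    push_cast [Nat.cast_sub hx']
    have : (Nat.card F : ℝ) ^ p.natDegree - 1 ≠ 0 := by linarith
    rw [pow_add]
    field_simp
    ring

open scoped Classical in
noncomputable def bb (F : Type*) [Field F] [Finite F] (k : ℕ) : ℝ := 
  ((Nat.card F : ℝ) ^ k)⁻¹ * ∑ m ∈ (MonD F k).filter Squarefree, (1:ℝ) / Phi m

theorem card_mult {F : Type*} [Field F] [Finite F] {n k : ℕ} (hk : k ≤ n) {m : F[X]} (hm : m ∈ MonD F k) 
   [DecidablePred fun f : F[X] => m ∣ f] :
    ((MonD F n).filter (fun f => m ∣ f)).card = Nat.card F ^ (n - k) := by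
  classical
  obtain ⟨h1, h2⟩ := mem_MonD.1 hm
  rw [← card_MonD]
  symm
  apply Finset.card_bij (fun f _ => m * f)
  · intro f hf
    obtain ⟨h3, h4⟩ := mem_MonD.1 hf
    rw [Finset.mem_filter, mem_MonD]
    refine ⟨⟨h1.mul h3, ?_⟩, dvd_mul_right _ _⟩
    rw [h1.natDegree_mul h3]; omega
  · intro a _ b _ h
    exact mul_left_cancel₀ h1.ne_zero h
  · intro f hf
    rw [Finset.mem_filter, mem_MonD] at hf
    obtain ⟨⟨h3, h4⟩, g, rfl⟩ := hf
    have h5 := h1.of_mul_monic_left h3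
    refine ⟨g, mem_MonD.2 ⟨h5, ?_⟩, rfl⟩
    rw [h1.natDegree_mul h5] at h4; omega

theorem SS_eq_sum (F : Type*) [Field F] [Finite F] (n : ℕ) :
    SS F n = ∑ k ∈ Finset.range (n+1), bb F k := by
  classical
  have hq : (1:ℝ) < Nat.card F := by exact_mod_cast Finite.one_lt_card
  have h1 : SS F n = ((Nat.card F : ℝ) ^ n)⁻¹ * ∑ f ∈ MonD F n, ∑ m ∈ SD f, (1:ℝ) / Phi m := by
    rw [SS, Finset.mul_sum]
    apply Finset.sum_congr rfl
    intro f hf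
    obtain ⟨h3, h4⟩ := mem_MonD.1 hf
    rw [← sum_SD _ f h3 rfl, h4]
    have : (Nat.card F : ℝ) ^ n ≠ 0 := by positivity
    field_simp
  have hdisj : (↑(Finset.range (n+1)) : Set ℕ).PairwiseDisjoint (MonD F) := by
    intro a _ b _ hab
    rw [Function.onFun, Finset.disjoint_left]
    intro f hf hf'
    exact hab ((mem_MonD.1 hf).2.symm.trans (mem_MonD.1 hf').2)
  have h2 : ∀ f ∈ MonD F n, ∑ m ∈ SD f, (1:ℝ) / Phi m = 
      ∑ k ∈ Finset.range (n+1), ∑ m ∈ MonD F k, if m ∣ f then (if Squarefree m then (1:ℝ) / Phi m else 0) else 0 := by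
    intro f hf
    obtain ⟨h3, h4⟩ := mem_MonD.1 hf
    rw [SD, h4, Finset.sum_filter, Finset.sum_biUnion hdisj]
    simp_rw [ite_and]
  rw [h1, Finset.sum_congr rfl h2, Finset.sum_comm, Finset.mul_sum]
  apply Finset.sum_congr rfl
  intro k hk
  have hk : k ≤ n := Nat.lt_succ_iff.1 (Finset.mem_range.1 hk)
  rw [Finset.sum_comm, bb, Finset.sum_filter, Finset.mul_sum, Finset.mul_sum]
  apply Finset.sum_congr rfl
  intro m hm
  rw [← Finset.sum_filter, Finset.sum_const, card_mult hk hm, nsmul_eq_mul, ← mul_assoc]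
  congr 1
  push_cast
  rw [← Nat.sub_add_cancel hk, pow_add]
  simp only [Nat.add_sub_cancel]
  field_simp

open Filter Topology

open scoped Classical in
noncomputable def WW {F : Type*} [Field F] (w : F[X] → ℝ) (P : Finset F[X]) : ℝ :=
  ∑' m, if (∀ p ∈ P, ¬ p ∣ m) then w m else 0

open scoped Classical in
noncomputable def PN (F : Type*) [Field F] [Finite F] (N : ℕ) : Finset F[X] :=
  ((Finset.range N).biUnion (MonD F)).filter Irreducible

theorem mem_PN {F : Type*} [Field F] [Finite F] {N : ℕ} {p : F[X]} :
    p ∈ PN F N ↔ p.Monic ∧ Irreducible p ∧ p.natDegree < N := by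
  simp only [PN, Finset.mem_filter, Finset.mem_biUnion, Finset.mem_range, mem_MonD]
  constructor
  · rintro ⟨⟨k, hk, h1, rfl⟩, h3⟩; exact ⟨h1, h3, hk⟩
  · rintro ⟨h1, h2, h3⟩; exact ⟨⟨_, h3, h1, rfl⟩, h2⟩

theorem WW_tendsto {F : Type*} [Field F] [Finite F] (w : F[X] → ℝ) (hw : Summable w)
    (h0 : ∀ m, 0 ≤ w m) (h1 : w 1 = 1) (hn : ∀ m, ¬ m.Monic → w m = 0) :
    Tendsto (fun N => WW w (PN F N)) atTop (𝓝 1) := by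
  classical
  have e1 : ∑' m : F[X], (if m = 1 then (1:ℝ) else 0) = 1 := by rw [tsum_ite_eq]
  rw [← e1]
  apply tendsto_tsum_of_dominated_convergence (bound := w) hw
  · intro m
    by_cases hm : m.Monic
    · by_cases hm1 : m = 1
      · subst hm1
        apply tendsto_const_nhds.congr
        intro N
        rw [if_pos rfl, if_pos, h1]
        intro p hp hd
        exact (mem_PN.1 hp).2.1.not_isUnit (isUnit_of_dvd_one hd)
      · have hu : ¬ IsUnit m := fun h => hm1 (hm.eq_one_of_isUnit h)
        obtain ⟨p, hp, hi, hd⟩ := Polynomial.exists_monic_irreducible_factor m hu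
        apply tendsto_const_nhds.congr'
        filter_upwards [eventually_gt_atTop p.natDegree] with N hN
        rw [if_neg hm1, if_neg]
        intro h
        exact h p (mem_PN.2 ⟨hp, hi, hN⟩) hd
    · have hm1 : m ≠ 1 := by rintro rfl; exact hm monic_one
      simp [hn m hm, hm1]
  · filter_upwards with N m
    split_ifs
    · rw [Real.norm_of_nonneg (h0 m)]
    · simpa using h0 m

theorem WW_split {F : Type*} [Field F] (w : F[X] → ℝ) (hw : Summable w)
    (P : Finset F[X]) (hP : ∀ p ∈ P, p.Monic ∧ Irreducible p) (p : F[X]) (hp : p.Monic)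
    (hi : Irreducible p) (hpP : p ∉ P) [DecidableEq F[X]] :
    WW w P = WW w (insert p P) + WW (fun m => w (p * m)) P := by
  classical
  have s1 : ∀ (P : F[X] → Prop) [DecidablePred P], Summable (fun m => if P m then w m else 0) := by
    intro P _
    apply Summable.of_norm_bounded hw.norm
    intro m
    split_ifs
    · exact le_rfl
    · simp
  have e2 : WW (fun m => w (p * m)) P = ∑' m, if (p ∣ m ∧ ∀ r ∈ P, ¬ r ∣ m) then w m else 0 := by
    rw [← Function.Injective.tsum_eq (g := fun m => p * m) (mul_right_injective₀ hp.ne_zero)]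
    · unfold WW
      apply tsum_congr
      intro m
      congr 1
      simp only [dvd_mul_right, true_and, eq_iff_iff]
      apply forall₂_congr
      intro r hr
      rw [not_iff_not]
      constructor
      · exact fun h => h.trans (dvd_mul_left _ _)
      · intro h
        obtain ⟨h1, h2⟩ := hP r hr
        rcases h2.prime.dvd_or_dvd h with h | h
        · exfalso
          apply hpP
          have := eq_of_monic_of_associated h1 hp (h2.associated_of_dvd hi h)
          rwa [← this]
        · exact h
    · intro m hm
      rw [Function.mem_support] at hm
      have : p ∣ m := by
        by_contra hcon
        exact hm (if_neg (fun h => hcon h.1))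
      obtain ⟨c, rfl⟩ := this
      exact ⟨c, rfl⟩
  rw [e2]
  unfold WW
  refine Eq.trans ?_ (Summable.tsum_add (s1 _) (s1 _))
  apply tsum_congr
  intro m
  by_cases h1 : p ∣ m <;> by_cases h2 : ∀ r ∈ P, ¬ r ∣ m <;> simp [h1, h2]

theorem WW_mult {F : Type*} [Field F] (w : F[X] → ℝ) (hw : Summable w) (a : F[X] → ℝ)
    (ha : ∀ p m : F[X], p.Monic → Irreducible p → w (p * m) = a p * w m)
    (P : Finset F[X]) : (∀ p ∈ P, p.Monic ∧ Irreducible p) → 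
    WW w P = WW w ∅ * ∏ p ∈ P, (1 - a p) := by
  classical
  induction P using Finset.induction_on with
  | empty => simp
  | insert p P hpP ih =>
    intro hP
    have hP' : ∀ p ∈ P, p.Monic ∧ Irreducible p := fun r hr => hP r (Finset.mem_insert_of_mem hr)
    obtain ⟨h1, h2⟩ := hP p (Finset.mem_insert_self _ _)
    have := WW_split w hw P hP' p h1 h2 hpP
    have e : WW (fun m => w (p * m)) P = a p * WW w P := by
      unfold WW
      rw [← tsum_mul_left]
      apply tsum_congr
      intro m
      beta_reduce
      rw [ha p m h1 h2, mul_ite, mul_zero]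
    rw [e] at this
    have ih := ih hP'
    rw [Finset.prod_insert hpP]
    linear_combination (-1) * this + (1 - a p) * ih

theorem WW_sqf {F : Type*} [Field F] (w : F[X] → ℝ) (hw : Summable w) (a : F[X] → ℝ)
    (ha : ∀ p m : F[X], p.Monic → Irreducible p → p ∣ m → w (p * m) = 0)
    (ha' : ∀ p m : F[X], p.Monic → Irreducible p → ¬ p ∣ m → w (p * m) = a p * w m)
    (P : Finset F[X]) : (∀ p ∈ P, p.Monic ∧ Irreducible p) → 
    WW w ∅ = WW w P * ∏ p ∈ P, (1 + a p) := by
  classical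
  induction P using Finset.induction_on with
  | empty => simp
  | insert p P hpP ih =>
    intro hP
    have hP' : ∀ p ∈ P, p.Monic ∧ Irreducible p := fun r hr => hP r (Finset.mem_insert_of_mem hr)
    obtain ⟨h1, h2⟩ := hP p (Finset.mem_insert_self _ _)
    have := WW_split w hw P hP' p h1 h2 hpP
    have e : WW (fun m => w (p * m)) P = a p * WW w (insert p P) := by
      unfold WW
      rw [← tsum_mul_left]
      apply tsum_congr
      intro m
      by_cases h4 : p ∣ m
      · simp [h4, ha p m h1 h2 h4]
      · by_cases h3 : ∀ r ∈ P, ¬ r ∣ m <;> simp [h4, h3, ha' p m h1 h2 h4]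
    rw [e] at this
    have ih := ih hP'
    rw [Finset.prod_insert hpP, ih, this]
    ring

theorem hasSum_mon {F : Type*} [Field F] [Finite F] (w : F[X] → ℝ) (h0 : ∀ m, 0 ≤ w m) 
    (hn : ∀ m, ¬ m.Monic → w m = 0) {S : ℝ} (h : HasSum (fun k => ∑ m ∈ MonD F k, w m) S) :
    HasSum w S := by
  classical
  have hdisj : ∀ N : ℕ, (↑(Finset.range N) : Set ℕ).PairwiseDisjoint (MonD F) := by
    intro N a _ b _ hab
    rw [Function.onFun, Finset.disjoint_left]
    intro f hf hf'
    exact hab ((mem_MonD.1 hf).2.symm.trans (mem_MonD.1 hf').2)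
  have hs : Summable w := by
    apply summable_of_sum_le (c := S) h0
    intro u
    calc ∑ x ∈ u, w x = ∑ x ∈ u.filter Monic, w x := by
          symm; apply Finset.sum_filter_of_ne
          intro x _ hx; by_contra hcon; exact hx (hn x hcon)
      _ ≤ ∑ x ∈ (Finset.range (u.sup natDegree + 1)).biUnion (MonD F), w x := by
          apply Finset.sum_le_sum_of_subset_of_nonneg
          · intro x hx
            rw [Finset.mem_filter] at hx
            rw [Finset.mem_biUnion]
            exact ⟨x.natDegree, Finset.mem_range.2 (Nat.lt_succ_of_le (Finset.le_sup hx.1)), mem_MonD.2 ⟨hx.2, rfl⟩⟩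
          · intro i _ _; exact h0 i
      _ = ∑ k ∈ Finset.range (u.sup natDegree + 1), ∑ m ∈ MonD F k, w m := 
          Finset.sum_biUnion (hdisj _)
      _ ≤ S := sum_le_hasSum _ (fun k _ => Finset.sum_nonneg (fun m _ => h0 m)) h
  have ht : Tendsto (fun N : ℕ => ∑' m : F[X], if m.natDegree < N then w m else 0) atTop (𝓝 (∑' m, w m)) := by
    apply tendsto_tsum_of_dominated_convergence (bound := w) hs
    · intro m
      apply tendsto_const_nhds.congr'
      filter_upwards [eventually_gt_atTop m.natDegree] with N hN
      rw [if_pos hN]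
    · filter_upwards with N m
      split_ifs
      · rw [Real.norm_of_nonneg (h0 m)]
      · simpa using h0 m
  have he : ∀ N : ℕ, (∑' m : F[X], if m.natDegree < N then w m else 0) = 
      ∑ k ∈ Finset.range N, ∑ m ∈ MonD F k, w m := by
    intro N
    rw [← Finset.sum_biUnion (hdisj _), tsum_eq_sum (s := (Finset.range N).biUnion (MonD F))]
    · apply Finset.sum_congr rfl
      intro m hm
      obtain ⟨k, hk, hm⟩ := Finset.mem_biUnion.1 hm
      rw [if_pos]
      rw [(mem_MonD.1 hm).2]; exact Finset.mem_range.1 hk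
    · intro m hm
      by_cases hmon : m.Monic
      · rw [if_neg]
        intro hlt
        exact hm (Finset.mem_biUnion.2 ⟨_, Finset.mem_range.2 hlt, mem_MonD.2 ⟨hmon, rfl⟩⟩)
      · rw [hn m hmon, ite_self]
  simp_rw [he] at ht
  rw [tendsto_nhds_unique h.tendsto_sum_nat ht]
  exact hs.hasSum

open scoped Classical in
noncomputable def zw (F : Type*) [Field F] [Finite F] (s : ℕ) (m : F[X]) : ℝ :=
  if m.Monic then (((Nat.card F : ℝ) ^ m.natDegree)⁻¹) ^ s else 0

open scoped Classical in
noncomputable def hw (F : Type*) [Field F] [Finite F] (m : F[X]) : ℝ :=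
  if m.Monic ∧ Squarefree m then ((Nat.card F : ℝ) ^ m.natDegree)⁻¹ * ((1:ℝ) / Phi m) else 0

theorem zw_nonneg (F : Type*) [Field F] [Finite F] (s : ℕ) (m : F[X]) : 0 ≤ zw F s m := by
  unfold zw; split_ifs <;> positivity

theorem hw_nonneg (F : Type*) [Field F] [Finite F] (m : F[X]) : 0 ≤ hw F m := by
  unfold hw; split_ifs <;> positivity

theorem zw_hasSum (F : Type*) [Field F] [Finite F] (t : ℕ) (ht : 1 ≤ t) :
    HasSum (zw F (t+1)) (1 - ((Nat.card F : ℝ)⁻¹) ^ t)⁻¹ := by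
  have hq : (1:ℝ) < Nat.card F := by exact_mod_cast Finite.one_lt_card
  apply hasSum_mon _ (zw_nonneg F _)
  · intro m hm; rw [zw, if_neg hm]
  · have : ∀ k, ∑ m ∈ MonD F k, zw F (t+1) m = (((Nat.card F : ℝ)⁻¹) ^ t) ^ k := by
      intro k
      have h2 : ∀ m ∈ MonD F k, zw F (t+1) m = (((Nat.card F : ℝ) ^ k)⁻¹) ^ (t+1) := by
        intro m hm
        obtain ⟨h1, h2⟩ := mem_MonD.1 hm
        rw [zw, if_pos h1, h2]
      rw [Finset.sum_congr rfl h2, Finset.sum_const, card_MonD, nsmul_eq_mul, pow_succ]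
      have : (Nat.card F : ℝ) ^ k ≠ 0 := by positivity
      push_cast
      rw [mul_comm, mul_assoc, inv_mul_cancel₀ this, mul_one, ← inv_pow, pow_right_comm]
    simp_rw [this]
    apply hasSum_geometric_of_lt_one (by positivity)
    exact pow_lt_one₀ (by positivity) (inv_lt_one_of_one_lt₀ hq) (by omega)

theorem zw_mul (F : Type*) [Field F] [Finite F] (s : ℕ) (p m : F[X]) (hp : p.Monic) :
    zw F s (p * m) = (((Nat.card F : ℝ) ^ p.natDegree)⁻¹) ^ s * zw F s m := by
  unfold zw
  by_cases hm : m.Monic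
  · rw [if_pos (hp.mul hm), if_pos hm, hp.natDegree_mul hm, pow_add, mul_inv, mul_pow]
  · rw [if_neg hm, if_neg (fun h => hm (hp.of_mul_monic_left h)), mul_zero]

theorem hw_sum (F : Type*) [Field F] [Finite F] (k : ℕ) : ∑ m ∈ MonD F k, hw F m = bb F k := by
  classical
  rw [bb, Finset.mul_sum, Finset.sum_filter]
  apply Finset.sum_congr rfl
  intro m hm
  obtain ⟨h1, h2⟩ := mem_MonD.1 hm
  simp only [hw, h1, true_and, h2]

theorem bb_tsum (F : Type*) [Field F] [Finite F] (hs : Summable (bb F)) :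
    ∑' k, bb F k = (1 - ((Nat.card F : ℝ)⁻¹) ^ 5) / ((1 - (Nat.card F : ℝ)⁻¹) * (1 - ((Nat.card F : ℝ)⁻¹) ^ 2)) := by
  classical
  have hq : (1:ℝ) < Nat.card F := by exact_mod_cast Finite.one_lt_card
  have hH : HasSum (hw F) (∑' k, bb F k) := by
    apply hasSum_mon _ (hw_nonneg F)
    · intro m hm; rw [hw, if_neg (fun h => hm h.1)]
    · simp_rw [hw_sum]; exact hs.hasSum
  have hwe : ∀ w : F[X] → ℝ, WW w ∅ = ∑' m, w m := by intro w; simp [WW]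
  have z1 : ∀ s, zw F s 1 = 1 := by intro s; simp [zw]
  have h1 : hw F 1 = 1 := by simp [hw, Phi_one]
  have tz : ∀ t, 1 ≤ t → Tendsto (fun N => WW (zw F (t+1)) (PN F N)) atTop (𝓝 1) := fun t ht =>
    WW_tendsto _ (zw_hasSum F t ht).summable (zw_nonneg F _) (z1 _) (fun m hm => by rw [zw, if_neg hm])
  have th : Tendsto (fun N => WW (hw F) (PN F N)) atTop (𝓝 1) := 
    WW_tendsto _ hH.summable (hw_nonneg F) h1 (fun m hm => by rw [hw, if_neg (fun h => hm h.1)])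
  have hPN : ∀ N, ∀ p ∈ PN F N, p.Monic ∧ Irreducible p := fun N p hp => 
    ⟨(mem_PN.1 hp).1, (mem_PN.1 hp).2.1⟩
  have ez : ∀ t, 1 ≤ t → ∀ N, WW (zw F (t+1)) (PN F N) = (1 - ((Nat.card F : ℝ)⁻¹) ^ t)⁻¹ * 
      ∏ p ∈ PN F N, (1 - (((Nat.card F : ℝ) ^ p.natDegree)⁻¹) ^ (t+1)) := by
    intro t ht N
    rw [WW_mult _ (zw_hasSum F t ht).summable (fun p => (((Nat.card F : ℝ) ^ p.natDegree)⁻¹) ^ (t+1))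
      (fun p m hp _ => zw_mul F _ p m hp) _ (hPN N), hwe, (zw_hasSum F t ht).tsum_eq]
  have eh : ∀ N, ∑' k, bb F k = WW (hw F) (PN F N) * ∏ p ∈ PN F N, 
      (1 + ((Nat.card F : ℝ) ^ p.natDegree * ((Nat.card F : ℝ) ^ p.natDegree - 1))⁻¹) := by
    intro N
    rw [← WW_sqf _ hH.summable (fun p => ((Nat.card F : ℝ) ^ p.natDegree * ((Nat.card F : ℝ) ^ p.natDegree - 1))⁻¹) _ _ _ (hPN N),
      hwe, hH.tsum_eq]
    · intro p m hp hi hd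
      rw [hw, if_neg]
      rintro ⟨-, h⟩
      exact not_dvd_of_sqfree hi h hd
    · intro p m hp hi hd
      have hx' : 1 ≤ Nat.card F ^ p.natDegree := Nat.one_le_pow _ _ Nat.card_pos
      by_cases hm : m.Monic ∧ Squarefree m
      · rw [hw, if_pos ⟨hp.mul hm.1, sqfree_mul hi hm.2 hd⟩, hw, if_pos hm, hp.natDegree_mul hm.1,
          Phi_mul_of_not_dvd hp hi hd, pow_add]
        push_cast [Nat.cast_sub hx']
        simp only [one_div, mul_inv]
        ring
      · rw [hw, if_neg, hw, if_neg hm, mul_zero]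
        rintro ⟨h1, h2⟩
        exact hm ⟨hp.of_mul_monic_left h1, h2.squarefree_of_dvd (dvd_mul_left _ _)⟩
  set x := (Nat.card F : ℝ)⁻¹ with hx
  have hx0 : 0 < x := by positivity
  have hx1 : x < 1 := inv_lt_one_of_one_lt₀ hq
  have d1 : 1 - x ^ 1 ≠ 0 := by rw [pow_one]; linarith
  have d2 : 1 - x ^ 2 ≠ 0 := by have := pow_lt_one₀ hx0.le hx1 two_ne_zero; linarith
  have d5 : 1 - x ^ 5 ≠ 0 := by have := pow_lt_one₀ hx0.le hx1 (n := 5) (by norm_num); linarith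
  have key : ∀ N, (∑' k, bb F k) * ((1 - x ^ 5)⁻¹ * (WW (zw F (1+1)) (PN F N) * WW (zw F (2+1)) (PN F N))) =
      WW (hw F) (PN F N) * WW (zw F (5+1)) (PN F N) * ((1 - x^1)⁻¹ * (1 - x^2)⁻¹) := by
    intro N
    rw [ez 1 le_rfl, ez 2 (by norm_num), ez 5 (by norm_num), eh N]
    have : ∏ p ∈ PN F N, (1 - (((Nat.card F : ℝ) ^ p.natDegree)⁻¹) ^ (5+1)) = 
       (∏ p ∈ PN F N, (1 + ((Nat.card F : ℝ) ^ p.natDegree * ((Nat.card F : ℝ) ^ p.natDegree - 1))⁻¹)) *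
       ((∏ p ∈ PN F N, (1 - (((Nat.card F : ℝ) ^ p.natDegree)⁻¹) ^ (1+1))) *
       (∏ p ∈ PN F N, (1 - (((Nat.card F : ℝ) ^ p.natDegree)⁻¹) ^ (2+1)))) := by
      rw [← Finset.prod_mul_distrib, ← Finset.prod_mul_distrib]
      apply Finset.prod_congr rfl
      intro p hp
      have hdp : 0 < p.natDegree := (hPN N p hp).2.natDegree_pos
      have hy : (1:ℝ) < (Nat.card F : ℝ) ^ p.natDegree := one_lt_pow₀ hq hdp.ne'
      generalize (Nat.card F : ℝ) ^ p.natDegree = y at hy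
      have hy1 : y - 1 ≠ 0 := by linarith
      have hy0 : y ≠ 0 := by linarith
      simp only [inv_pow]
      norm_num
      field_simp
      ring
    rw [this]
    ring
  have lim1 := (((tz 1 le_rfl).mul (tz 2 (by norm_num))).const_mul ((1 - x ^ 5)⁻¹)).const_mul (∑' k, bb F k)
  have lim2 := (th.mul (tz 5 (by norm_num))).mul_const ((1 - x^1)⁻¹ * (1 - x^2)⁻¹)
  have := tendsto_nhds_unique (lim1.congr key) lim2
  rw [pow_one] at this d1
  field_simp at this ⊢
  linarith

theorem om_lim (q : ℝ) (hq : 1 < q) :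
    Tendsto (om q) atTop (𝓝 ((1 - q⁻¹) * (1 - q⁻¹ ^ 2) * ∏' r : ℕ, (1 - q⁻¹ ^ (r + 3)))) ∧
    0 < (1 - q⁻¹) * (1 - q⁻¹ ^ 2) * ∏' r : ℕ, (1 - q⁻¹ ^ (r + 3)) ∧
    ∀ n, (1 - q⁻¹) * (1 - q⁻¹ ^ 2) * ∏' r : ℕ, (1 - q⁻¹ ^ (r + 3)) ≤ om q n := by
  set x := q⁻¹ with hx
  have hx0 : 0 < x := by positivity
  have hx1 : x < 1 := inv_lt_one_of_one_lt₀ hq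
  have hs : ∀ k, Summable (fun r : ℕ => ‖-x ^ (r + k)‖) := by
    intro k
    have := (summable_geometric_of_lt_one hx0.le hx1).mul_left (x ^ k)
    apply this.congr
    intro r
    rw [norm_neg, Real.norm_of_nonneg (by positivity), pow_add, mul_comm]
  have hm : ∀ k, Multipliable (fun r : ℕ => 1 - x ^ (r + k)) := by
    intro k
    simpa only [sub_eq_add_neg] using multipliable_one_add_of_summable (hs k)
  have hfac : ∀ r : ℕ, 0 < 1 - x ^ (r + 1) := by
    intro r
    have := pow_lt_one₀ hx0.le hx1 (n := r + 1) (by omega)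
    linarith
  have hne : ∏' r : ℕ, (1 - x ^ (r + 1)) ≠ 0 := by
    have := tprod_one_add_ne_zero_of_summable (f := fun r : ℕ => - x ^ (r + 1)) 
      (fun r => by rw [← sub_eq_add_neg]; exact (hfac r).ne') (hs 1)
    simpa only [sub_eq_add_neg] using this
  have e1 : (1 - x) * (1 - x ^ 2) * ∏' r : ℕ, (1 - x ^ (r + 3)) = ∏' r : ℕ, (1 - x ^ (r + 1)) := by
    have := Multipliable.prod_mul_tprod_nat_mul' (f := fun r : ℕ => 1 - x ^ (r + 1)) (k := 2) (hm 3)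
    rw [← this]
    simp [Finset.prod_range_succ]
  rw [e1]
  have ht : Tendsto (om q) atTop (𝓝 (∏' r : ℕ, (1 - x ^ (r + 1)))) := (hm 1).hasProd.tendsto_prod_nat
  have hpos : ∀ n, 0 < om q n := fun n => Finset.prod_pos (fun i _ => hfac i)
  have hanti : Antitone (om q) := by
    apply antitone_nat_of_succ_le
    intro n
    have : om q (n+1) = om q n * (1 - x ^ (n + 1)) := Finset.prod_range_succ _ _
    rw [this]
    have h3 : 0 < x ^ (n+1) := by positivity
    nlinarith [hpos n]
  refine ⟨ht, ?_, fun n => hanti.le_of_tendsto ht n⟩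
  exact lt_of_le_of_ne (ge_of_tendsto' ht (fun n => (hpos n).le)) hne.symm

theorem bb_nonneg (F : Type*) [Field F] [Finite F] (k : ℕ) : 0 ≤ bb F k := by
  unfold bb; positivity

theorem bb_lt (F : Type*) [Field F] [Finite F] (k : ℕ) (hk : 2 ≤ k) :
    bb F k < ((Nat.card F : ℝ)⁻¹) ^ k * SS F k := by
  classical
  have hq : (1:ℝ) < Nat.card F := by exact_mod_cast Finite.one_lt_card
  rw [bb, ← inv_pow, SS]
  apply mul_lt_mul_of_pos_left _ (by positivity)
  apply Finset.sum_lt_sum_of_subset (i := X ^ k) (Finset.filter_subset _ _)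
  · rw [mem_MonD]; exact ⟨monic_X_pow k, natDegree_X_pow k⟩
  · intro h
    have := (Finset.mem_filter.1 h).2
    have h2 := this X (by rw [← sq]; exact pow_dvd_pow _ hk)
    exact not_isUnit_X h2
  · have : (0:ℝ) < Phi (X ^ k : F[X]) := by exact_mod_cast Phi_pos (monic_X_pow k)
    positivity
  · intro j _ _; positivity

/-- With `c_M(∞,q) = (1 − q^{−5}) ∏_{r=3}^∞ (1 − q^{−r})`, for all `n ≥ 1`,
`0 < |c_M(n,q) − c_M(∞,q)| < 1/(q^{n+1}(1 − 1/q))`. -/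
theorem cyclicProportion_convergence_rate {F : Type} [Field F] [Fintype F] (q : ℕ)
    (hq : Fintype.card F = q) (n : ℕ) (hn : 1 ≤ n) :
    0 < |cyclicProportion F n -
          (1 - ((q : ℝ))⁻¹ ^ 5) * ∏' r : ℕ, (1 - ((q : ℝ))⁻¹ ^ (r + 3))| ∧
    |cyclicProportion F n -
          (1 - ((q : ℝ))⁻¹ ^ 5) * ∏' r : ℕ, (1 - ((q : ℝ))⁻¹ ^ (r + 3))| <
      1 / ((q : ℝ) ^ (n + 1) * (1 - 1 / (q : ℝ))) := by
  have hq1 : (1:ℝ) < q := by rw [← hq]; exact_mod_cast Fintype.one_lt_card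
  have hcard : Nat.card F = q := by rw [Nat.card_eq_fintype_card, hq]
  obtain ⟨ht, hL, hle⟩ := om_lim q hq1
  set T := ∏' r : ℕ, (1 - ((q : ℝ))⁻¹ ^ (r + 3)) with hT
  set x := (q : ℝ)⁻¹ with hx
  have hx0 : 0 < x := by positivity
  have hx1 : x < 1 := inv_lt_one_of_one_lt₀ hq1
  set L := (1 - x) * (1 - x ^ 2) * T with hLdef
  have hompos : ∀ n, 0 < om q n := fun n => hL.trans_le (hle n)
  have hc : ∀ n, cyclicProportion F n = om q n * SS F n := by
    intro n; rw [cyc_eq, hq]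
  have hc1 : ∀ n, cyclicProportion F n ≤ 1 := by
    intro n
    rw [cyclicProportion]
    apply div_le_one_of_le₀ _ (by positivity)
    have h1 := Finite.card_subtype_le (fun A : Matrix (Fin n) (Fin n) F => A.charpoly = minpoly F A)
    have h2 : Nat.card (Matrix (Fin n) (Fin n) F) = Fintype.card F ^ (n ^ 2) := by
      rw [Matrix, Nat.card_fun, Nat.card_fun, Nat.card_fin, Nat.card_eq_fintype_card, ← pow_mul, sq]
    rw [h2] at h1
    exact_mod_cast h1
  have hSn : ∀ n, 0 ≤ SS F n := fun n => by unfold SS; positivity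
  have hsum : Summable (bb F) := by
    apply summable_of_sum_range_le (c := L⁻¹) (bb_nonneg F)
    intro n
    have h1 : ∑ k ∈ Finset.range n, bb F k ≤ SS F n := by
      rw [SS_eq_sum, Finset.sum_range_succ]
      linarith [bb_nonneg F n]
    refine h1.trans ?_
    rw [← one_div, le_div_iff₀ hL, mul_comm]
    have := hc1 n
    rw [hc] at this
    exact (mul_le_mul_of_nonneg_right (hle n) (hSn n)).trans this
  have hSlim : Tendsto (SS F) atTop (𝓝 (∑' k, bb F k)) := by
    have := (tendsto_add_atTop_iff_nat 1).2 hsum.hasSum.tendsto_sum_nat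
    exact this.congr (fun n => (SS_eq_sum F n).symm)
  have hd1 : 0 < 1 - x := by linarith
  have hpw : ∀ n, x ^ (n + 1) < 1 := fun n => pow_lt_one₀ hx0.le hx1 (by omega)
  have hd2 : 0 < 1 - x ^ 2 := sub_pos.2 (hpw 1)
  have hclim : Tendsto (cyclicProportion F) atTop (𝓝 ((1 - x ^ 5) * T)) := by
    have h1 := ht.mul hSlim
    rw [bb_tsum F hsum, hcard] at h1
    have e : L * ((1 - x ^ 5) / ((1 - x) * (1 - x ^ 2))) = (1 - x ^ 5) * T := by
      rw [hLdef]; field_simp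
    change Tendsto _ _ (𝓝 (L * ((1 - x ^ 5) / ((1 - x) * (1 - x ^ 2))))) at h1
    rw [e] at h1
    exact h1.congr (fun n => (hc n).symm)
  have homs : ∀ n, om q (n+1) = om q n * (1 - x ^ (n + 1)) := fun n => Finset.prod_range_succ _ _
  have hSs : ∀ n, SS F (n+1) = SS F n + bb F (n+1) := fun n => by
    rw [SS_eq_sum, Finset.sum_range_succ, ← SS_eq_sum]
  have step1 : ∀ n, 1 ≤ n → cyclicProportion F (n+1) < cyclicProportion F n := by
    intro n hn
    have hb := bb_lt F (n+1) (by omega)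
    rw [hcard] at hb
    change _ < x ^ (n+1) * _ at hb
    rw [hc, hc, homs, mul_assoc]
    apply mul_lt_mul_of_pos_left _ (hompos n)
    linarith [hSs n]
  have step2 : ∀ n, cyclicProportion F n - cyclicProportion F (n+1) ≤ x ^ (n+1) * cyclicProportion F n := by
    intro n
    rw [hc, hc, homs, hSs]
    have : 0 ≤ om q n * ((1 - x ^ (n+1)) * bb F (n+1)) :=
      mul_nonneg (hompos n).le (mul_nonneg (by linarith [hpw n]) (bb_nonneg F _))
    linarith
  have lower : (1 - x ^ 5) * T < cyclicProportion F n := by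
    have hanti : Antitone (fun k => cyclicProportion F (k + n)) := by
      apply antitone_nat_of_succ_le
      intro k
      rw [show k + 1 + n = (k + n) + 1 by ring]
      exact (step1 (k + n) (by omega)).le
    have h1 := hanti.le_of_tendsto ((tendsto_add_atTop_iff_nat n).2 hclim) 1
    have h2 := step1 n hn
    simp only [add_comm 1 n] at h1
    linarith
  have upper : cyclicProportion F n - x ^ (n+1) / (1 - x) < (1 - x ^ 5) * T := by
    have hgap : ∀ n, (cyclicProportion F (n+1) - x ^ (n+1+1) / (1 - x)) - (cyclicProportion F n - x ^ (n+1) / (1 - x))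
        = x ^ (n+1) - (cyclicProportion F n - cyclicProportion F (n+1)) := by
      intro n
      field_simp
      ring
    have hmono : Monotone (fun k => cyclicProportion F k - x ^ (k+1) / (1 - x)) := by
      apply monotone_nat_of_le_succ
      intro k
      have h1 := hgap k
      have h2 := step2 k
      have h3 : x ^ (k+1) * cyclicProportion F k ≤ x ^ (k+1) := 
        mul_le_of_le_one_right (by positivity) (hc1 k)
      linarith
    have hlim : Tendsto (fun k => cyclicProportion F k - x ^ (k+1) / (1 - x)) atTop (𝓝 ((1 - x ^ 5) * T)) := by
      have h1 := (tendsto_add_atTop_iff_nat 1).2 (tendsto_pow_atTop_nhds_zero_of_lt_one hx0.le hx1)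
      have h2 := hclim.sub (h1.div_const (1 - x))
      simpa using h2
    have h1 := hmono.ge_of_tendsto hlim (n + 2)
    have h2 := hmono (Nat.le_succ n)
    have h3 := hgap (n+1)
    have h4 := step2 (n+1)
    have h5 : x ^ (n+1+1) * cyclicProportion F (n+1) < x ^ (n+1+1) :=
      mul_lt_of_lt_one_right (by positivity) ((step1 n hn).trans_le (hc1 n))
    simp only [Nat.succ_eq_add_one] at h2
    have h1' : cyclicProportion F (n + 1 + 1) - x ^ (n + 1 + 1 + 1) / (1 - x) ≤ (1 - x ^ 5) * T := h1
    linarith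
  have hbound : 1 / ((q : ℝ) ^ (n + 1) * (1 - 1 / (q : ℝ))) = x ^ (n+1) / (1 - x) := by
    rw [one_div (q : ℝ), ← hx, hx, inv_pow, one_div, mul_inv, div_eq_mul_inv]
  rw [hbound, abs_of_pos (by linarith)]
  constructor <;> linarith
end
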